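/- Let D be a DAG on a finite index set I with finite value types, and let p be a positive joint pmf that is Markov compatible with and faithful to D. Let X = {X₁, …, X_k} (k ≥ 1, distinct), {Y}, and W be pairwise disjoint subsets of I with causal ordering W < X < {Y} in D, and for each i let X_iᴺ = X \ De(X_i) be the vertices of X that are not descendants of X_i. Suppose there exist W₁, …, W_k ∈ W and T_i ⊆ (W \ {W₁, …, W_k}) ∪ X_iᴺ such that for every i, under p: (i) W_i and Y are NOT conditionally independent given T_i, and (ii) W_i and Y are conditionally independent given T_i ∪ {X_i}. Then for every i: there is a directed path from X_i to Y in D with at least one edge; T_i is an adjustment set relative to ({X_i}, {Y}) in D; there exists a minimal adjustment set Z_i ⊆ T_i relative to ({X_i}, {Y}) in D; and for every choice of such minimal adjustment sets Z₁, …, Z_k, the set Z := (⋃_{i=1}^k Z_i) \ X is an adjustment set relative to (X, {Y}) in D. -/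

import Mathlib

open scoped Classical

variable {V : Type*}

/-- `a` is an ancestor of `b` (every vertex is its own ancestor). -/
def Anc (E : V → V → Prop) (a b : V) : Prop := Relation.ReflTransGen E a b

/-- A path in a directed graph `E` from `a` to `b`: a sequence of distinct vertices
`a = vtx 0, …, vtx len = b` (`len ≥ 1`) in which consecutive vertices are joined
by an edge of `E` in either direction. -/
structure GPath (E : V → V → Prop) (a b : V) where
  len : ℕ
  len_pos : 0 < len
  vtx : ℕ → V
  first : vtx 0 = a
  last : vtx len = b
  inj : ∀ i j, i ≤ len → j ≤ len → vtx i = vtx j → i = j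
  adj : ∀ i, i < len → E (vtx i) (vtx (i + 1)) ∨ E (vtx (i + 1)) (vtx i)

namespace GPath

variable {E : V → V → Prop} {a b : V}

/-- The interior vertex at position `i` is a collider on the path. -/
def IsColliderAt (p : GPath E a b) (i : ℕ) : Prop :=
  0 < i ∧ i < p.len ∧ E (p.vtx (i - 1)) (p.vtx i) ∧ E (p.vtx (i + 1)) (p.vtx i)

/-- A path is open given `S` if no non-collider on it lies in `S` and every collider
on it has a descendant in `S`. -/
def OpenGiven (p : GPath E a b) (S : Set V) : Prop :=
  (∀ i, 0 < i → i < p.len → ¬ p.IsColliderAt i → p.vtx i ∉ S) ∧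
  (∀ i, p.IsColliderAt i → ∃ d ∈ S, Anc E (p.vtx i) d)

/-- A back-door path: the first edge points into the first vertex. -/
def IsBackdoor (p : GPath E a b) : Prop := E (p.vtx 1) (p.vtx 0)

/-- A causal (directed) path. -/
def Causal (p : GPath E a b) : Prop := ∀ i, i < p.len → E (p.vtx i) (p.vtx (i + 1))

/-- A path is proper with respect to `X` if only its first vertex lies in `X`. -/
def ProperFrom (p : GPath E a b) (X : Set V) : Prop :=
  ∀ i, 0 < i → i ≤ p.len → p.vtx i ∉ X

/-- The vertex `w` lies on the path. -/
def MemV (p : GPath E a b) (w : V) : Prop := ∃ i ≤ p.len, p.vtx i = w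

/-- The number of colliders on the path. -/
noncomputable def numColliders (p : GPath E a b) : ℕ := Set.ncard {i | p.IsColliderAt i}

end GPath

/-- `A` and `B` are d-separated given `S`: every path from `A` to `B` is blocked given `S`. -/
def DSep (E : V → V → Prop) (A B S : Set V) : Prop :=
  ∀ a ∈ A, ∀ b ∈ B, ∀ p : GPath E a b, ¬ p.OpenGiven S

/-- `A` and `B` are d-connected given `S`: some path from `A` to `B` is open given `S`. -/
def DConn (E : V → V → Prop) (A B S : Set V) : Prop :=
  ∃ a ∈ A, ∃ b ∈ B, ∃ p : GPath E a b, p.OpenGiven S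

/-- The set of descendants of a vertex set `S`. -/
def descendants (E : V → V → Prop) (S : Set V) : Set V := {d | ∃ s ∈ S, Anc E s d}

/-- `S` blocks every back-door path from `x` to `y`. -/
def BlocksBackdoor (E : V → V → Prop) (x y : V) (S : Set V) : Prop :=
  ∀ p : GPath E x y, p.IsBackdoor → ¬ p.OpenGiven S

/-- The back-door criterion for `Z` relative to `(X, Y)`. -/
def BackdoorCriterion (E : V → V → Prop) (X Y Z : Set V) : Prop :=
  Z ∩ descendants E X = ∅ ∧
  ∀ x ∈ X, ∀ y ∈ Y, BlocksBackdoor E x y (Z ∪ (X \ {x}))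

/-- The adjustment criterion for `Z` relative to `(X, Y)`: (a) `Z` contains no
descendant of any `w ∉ X` lying on a proper causal path from `X` to `Y`, and
(b) `Z` blocks every proper non-causal path from `X` to `Y`. -/
def AdjustmentCriterion (E : V → V → Prop) (X Y Z : Set V) : Prop :=
  (∀ w, w ∉ X →
      (∃ x ∈ X, ∃ y ∈ Y, ∃ p : GPath E x y, p.ProperFrom X ∧ p.Causal ∧ p.MemV w) →
      ∀ z ∈ Z, ¬ Anc E w z) ∧
  (∀ x ∈ X, ∀ y ∈ Y, ∀ p : GPath E x y, p.ProperFrom X → ¬ p.Causal → ¬ p.OpenGiven Z)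

variable {I : Type*} [Fintype I] {α : I → Type*} [∀ i, Fintype (α i)] [∀ i, Nonempty (α i)]

/-- The marginal probability, under the joint pmf `p`, that the coordinates in `S`
take the values `x` assigns them. -/
noncomputable def prS (p : (∀ i, α i) → ℝ) (S : Set I) (x : ∀ i, α i) : ℝ :=
  ∑ᶠ v ∈ {v : ∀ i, α i | ∀ i ∈ S, v i = x i}, p v

/-- `p` is a joint probability mass function. -/
def IsPMF (p : (∀ i, α i) → ℝ) : Prop := (∀ v, 0 ≤ p v) ∧ ∑ᶠ v, p v = 1

/-- The conditional probability of the assignment `x` on `A` given its values on `S`. -/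
noncomputable def condPr (p : (∀ i, α i) → ℝ) (A S : Set I) (x : ∀ i, α i) : ℝ :=
  prS p (A ∪ S) x / prS p S x

/-- Conditional independence `A ⫫ B | S` under `p`. -/
def CondIndep (p : (∀ i, α i) → ℝ) (A B S : Set I) : Prop :=
  ∀ x : ∀ i, α i, condPr p (A ∪ B) S x = condPr p A S x * condPr p B S x

/-- `p` is Markov compatible with the DAG `E`: it factorizes along parents. -/
def MarkovCompat (p : (∀ i, α i) → ℝ) (E : I → I → Prop) : Prop :=
  ∀ v, p v = ∏ᶠ i, condPr p {i} {j | E j i} v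

/-- `p` is faithful to `E`: conditional independence holds exactly for d-separations. -/
def Faithful (p : (∀ i, α i) → ℝ) (E : I → I → Prop) : Prop :=
  ∀ A B S : Set I, Disjoint A B → Disjoint S (A ∪ B) →
    (CondIndep p A B S ↔ DSep E A B S)

/-- The interventional pmf `p(v | do(x))` (the truncated factorization). -/
noncomputable def doPMF (p : (∀ i, α i) → ℝ) (E : I → I → Prop) (X : Set I)
    (x v : ∀ i, α i) : ℝ :=
  if ∀ i ∈ X, v i = x i then ∏ᶠ i ∈ Xᶜ, condPr p {i} {j | E j i} v else 0

/-- Combine the assignment `x` on `X`, the partial assignment `z` on `Z`, and the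
assignment `y` elsewhere into one full assignment. -/
noncomputable def mergeVals (X Z : Set I) (x : ∀ i, α i) (z : ∀ j : Z, α j.1)
    (y : ∀ i, α i) : ∀ i, α i :=
  fun i => if h : i ∈ Z then z ⟨i, h⟩ else if i ∈ X then x i else y i

/-- `Z` is an adjustment set relative to `(X, Y)` in the DAG `E`: for every positive
pmf `q` that is Markov compatible with `E` and all value assignments `x`, `y`,
the interventional probability of `y` on `Y` under `do(x)` equals
`∑ z, q(y | x, z) · q(z)`. -/
def IsAdjustmentSet (E : I → I → Prop) (X Y Z : Set I) : Prop :=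
  ∀ q : (∀ i, α i) → ℝ, IsPMF q → (∀ v, 0 < q v) → MarkovCompat q E →
    ∀ x y : ∀ i, α i,
      (∑ᶠ v ∈ {v : ∀ i, α i | ∀ i ∈ Y, v i = y i}, doPMF q E X x v) =
      ∑ᶠ z : (∀ j : Z, α j.1),
        condPr q Y (X ∪ Z) (mergeVals X Z x z y) * prS q Z (mergeVals X Z x z y)

/-- `Z` is a minimal adjustment set relative to `(X, Y)`: it is an adjustment set
and no proper subset of it is. -/
def MinimalAdjustmentSet (E : I → I → Prop) (X Y Z : Set I) : Prop :=
  IsAdjustmentSet (α := α) E X Y Z ∧ ∀ Z', Z' ⊂ Z → ¬ IsAdjustmentSet (α := α) E X Y Z'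


set_option linter.all false


/-- Sum `F` over the coordinates in `D`, the others being kept as in `v`. -/
noncomputable def Mg (D : Set I) (F : (∀ i, α i) → ℝ) (v : ∀ i, α i) : ℝ :=
  ∑ w : ∀ i, α i, if (∀ i, i ∉ D → w i = v i) then F w else 0

/-- `F` depends only on the coordinates in `S`. -/
def DepOn (F : (∀ i, α i) → ℝ) (S : Set I) : Prop :=
  ∀ v w, (∀ i ∈ S, v i = w i) → F v = F w

theorem DepOn.mono {F : (∀ i, α i) → ℝ} {S S' : Set I} (h : DepOn F S) (hs : S ⊆ S') :
    DepOn F S' := fun v w hvw => h v w fun i hi => hvw i (hs hi)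

theorem prS_eq (p : (∀ i, α i) → ℝ) (S : Set I) (x : ∀ i, α i) : prS p S x = Mg Sᶜ p x := by
  unfold prS Mg
  rw [finsum_eq_sum_of_fintype]
  refine Finset.sum_congr rfl fun v _ => ?_
  rw [finsum_eq_if]
  simp

theorem Mg_congr {D : Set I} {F G : (∀ i, α i) → ℝ} {v : ∀ i, α i}
    (h : ∀ w, (∀ i, i ∉ D → w i = v i) → F w = G w) : Mg D F v = Mg D G v := by
  unfold Mg
  refine Finset.sum_congr rfl fun w _ => ?_
  split_ifs with hw
  · exact h w hw
  · rfl

theorem Mg_eq_filter (D : Set I) (F : (∀ i, α i) → ℝ) (v : ∀ i, α i) :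
    Mg D F v = ∑ w ∈ Finset.univ.filter (fun w : ∀ i, α i => ∀ i, i ∉ D → w i = v i), F w :=
  (Finset.sum_filter _ _).symm

theorem Mg_mul_left' {D : Set I} {F G : (∀ i, α i) → ℝ} {v : ∀ i, α i}
    (h : ∀ w, (∀ i, i ∉ D → w i = v i) → F w = F v) :
    Mg D (fun w => F w * G w) v = F v * Mg D G v := by
  unfold Mg
  rw [Finset.mul_sum]
  refine Finset.sum_congr rfl fun w _ => ?_
  split_ifs with hw
  · show F w * G w = _
    rw [h w hw]
  · simp

theorem Mg_mul_left {D S : Set I} {F G : (∀ i, α i) → ℝ} (v : ∀ i, α i)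
    (hF : DepOn F S) (hd : Disjoint S D) :
    Mg D (fun w => F w * G w) v = F v * Mg D G v := by
  apply Mg_mul_left'
  intro w hw
  exact hF _ _ fun i hi => hw i (Set.disjoint_left.1 hd hi)

theorem Mg_add {D : Set I} {F G : (∀ i, α i) → ℝ} (v : ∀ i, α i) :
    Mg D (fun w => F w + G w) v = Mg D F v + Mg D G v := by
  unfold Mg
  rw [← Finset.sum_add_distrib]
  refine Finset.sum_congr rfl fun w _ => ?_
  split_ifs <;> simp

theorem Mg_const_mul {D : Set I} {F : (∀ i, α i) → ℝ} (c : ℝ) (v : ∀ i, α i) :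
    Mg D (fun w => c * F w) v = c * Mg D F v :=
  Mg_mul_left' (F := fun _ => c) (fun _ _ => rfl)

theorem Mg_pos {D : Set I} {F : (∀ i, α i) → ℝ} (v : ∀ i, α i) (hF : ∀ w, 0 < F w) :
    0 < Mg D F v := by
  unfold Mg
  refine Finset.sum_pos' (fun w _ => ?_) ⟨v, Finset.mem_univ _, ?_⟩
  · split_ifs
    · exact (hF w).le
    · exact le_rfl
  · simp [hF]

theorem Mg_empty (F : (∀ i, α i) → ℝ) (v : ∀ i, α i) : Mg ∅ F v = F v := by
  unfold Mg
  rw [Finset.sum_eq_single v]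
  · simp
  · intro b _ hb
    rw [if_neg]
    intro h
    exact hb (funext fun i => h i (by simp))
  · simp

theorem Mg_univ (F : (∀ i, α i) → ℝ) (v : ∀ i, α i) : Mg Set.univ F v = ∑ w, F w := by
  unfold Mg
  simp

theorem Mg_singleton (i : I) (F : (∀ i, α i) → ℝ) (v : ∀ i, α i) :
    Mg {i} F v = ∑ a, F (Function.update v i a) := by
  rw [Mg_eq_filter]
  symm
  refine Finset.sum_bij (fun a _ => Function.update v i a) ?_ ?_ ?_ ?_
  · intro a _
    simp only [Finset.mem_filter, Finset.mem_univ, true_and]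
    intro j hj
    rw [Function.update_of_ne hj]
  · intro a _ b _ h
    have := congrFun h i
    simpa using this
  · intro w hw
    simp only [Finset.mem_filter, Finset.mem_univ, true_and] at hw
    refine ⟨w i, Finset.mem_univ _, ?_⟩
    funext j
    by_cases hj : j = i
    · subst hj; simp
    · rw [Function.update_of_ne hj, hw j hj]
  · intro a _; rfl

theorem Mg_Mg {D D' : Set I} (hd : Disjoint D D') (F : (∀ i, α i) → ℝ) (v : ∀ i, α i) :
    Mg D (Mg D' F) v = Mg (D ∪ D') F v := by
  unfold Mg
  have : ∀ w : ∀ i, α i, (if (∀ i, i ∉ D → w i = v i) then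
      ∑ u : ∀ i, α i, (if (∀ i, i ∉ D' → u i = w i) then F u else 0) else 0) =
      ∑ u : ∀ i, α i, (if w = D.piecewise u v then
        (if (∀ i, i ∉ D ∪ D' → u i = v i) then F u else 0) else 0) := by
    intro w
    split_ifs with hw
    · refine Finset.sum_congr rfl fun u _ => ?_
      rw [← ite_and]
      refine if_congr ⟨fun h => ⟨?_, ?_⟩, fun h => ?_⟩ rfl rfl
      · funext i
        by_cases hi : i ∈ D
        · rw [Set.piecewise_eq_of_mem _ _ _ hi, h i (Set.disjoint_left.1 hd hi)]
        · rw [Set.piecewise_eq_of_notMem _ _ _ hi, hw i hi]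
      · intro i hi
        rw [h i (fun h' => hi (Or.inr h')), hw i (fun h' => hi (Or.inl h'))]
      · intro i hi
        rw [h.1]
        by_cases hi' : i ∈ D
        · rw [Set.piecewise_eq_of_mem _ _ _ hi']
        · rw [Set.piecewise_eq_of_notMem _ _ _ hi', h.2 i (by simp [hi, hi'])]
    · symm
      refine Finset.sum_eq_zero fun u _ => ?_
      rw [if_neg]
      rintro rfl
      apply hw
      intro i hi
      rw [Set.piecewise_eq_of_notMem _ _ _ hi]
  rw [Finset.sum_congr rfl fun w _ => this w, Finset.sum_comm]
  refine Finset.sum_congr rfl fun u _ => ?_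
  rw [Finset.sum_ite_eq' Finset.univ (D.piecewise u v)]
  simp

theorem DepOn_Mg {D S : Set I} {F : (∀ i, α i) → ℝ} (hF : DepOn F S) :
    DepOn (Mg D F) (S \ D) := by
  intro v w hvw
  unfold Mg
  rw [← Finset.sum_filter, ← Finset.sum_filter]
  refine Finset.sum_nbij' (fun u => D.piecewise u w) (fun u => D.piecewise u v) ?_ ?_ ?_ ?_ ?_
  · intro u _
    simp only [Finset.mem_filter, Finset.mem_univ, true_and]
    intro i hi
    rw [Set.piecewise_eq_of_notMem _ _ _ hi]
  · intro u _
    simp only [Finset.mem_filter, Finset.mem_univ, true_and]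
    intro i hi
    rw [Set.piecewise_eq_of_notMem _ _ _ hi]
  · intro u hu
    simp only [Finset.mem_filter, Finset.mem_univ, true_and] at hu
    funext i
    by_cases hi : i ∈ D
    · simp [hi]
    · simp [hi, hu i hi]
  · intro u hu
    simp only [Finset.mem_filter, Finset.mem_univ, true_and] at hu
    funext i
    by_cases hi : i ∈ D
    · simp [hi]
    · simp [hi, hu i hi]
  · intro u hu
    simp only [Finset.mem_filter, Finset.mem_univ, true_and] at hu
    apply hF
    intro i hi
    by_cases hi' : i ∈ D
    · simp [hi']
    · simp [hi', hu i hi', hvw i ⟨hi, hi'⟩]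

/-- Product splitting of sums. -/
theorem Mg_mul {C D : Set I} {F G : (∀ i, α i) → ℝ} (v : ∀ i, α i) (hCD : Disjoint C D)
    {SF SG : Set I} (hF : DepOn F SF) (hG : DepOn G SG) (hFD : Disjoint SF D)
    (hGC : Disjoint SG C) :
    Mg (C ∪ D) (fun w => F w * G w) v = Mg C F v * Mg D G v := by
  rw [← Mg_Mg hCD]
  have : Mg D (fun w => F w * G w) = fun w => Mg D G w * F w := by
    funext w
    rw [Mg_mul_left w hF hFD, mul_comm]
  rw [this, Mg_mul_left v (DepOn_Mg hG) (hGC.mono_left Set.sdiff_subset), mul_comm]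

theorem DepOn.mul {F G : (∀ i, α i) → ℝ} {S : Set I} (hF : DepOn F S) (hG : DepOn G S) :
    DepOn (fun w => F w * G w) S := fun v w h => by
  show F v * G v = F w * G w
  rw [hF v w h, hG v w h]

/-- Product of the kernels with index in `S`. -/
noncomputable def PK (k : I → (∀ i, α i) → ℝ) (S : Set I) (v : ∀ i, α i) : ℝ :=
  ∏ i, if i ∈ S then k i v else 1

theorem PK_union {k : I → (∀ i, α i) → ℝ} {S T : Set I} (h : Disjoint S T) (v : ∀ i, α i) :
    PK k (S ∪ T) v = PK k S v * PK k T v := by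
  unfold PK
  rw [← Finset.prod_mul_distrib]
  refine Finset.prod_congr rfl fun i _ => ?_
  by_cases h1 : i ∈ S
  · simp [h1, Set.disjoint_left.1 h h1]
  · simp [h1]

theorem PK_split {k : I → (∀ i, α i) → ℝ} {S T U : Set I} (h : Disjoint S T) (hU : U = S ∪ T) :
    PK k U = fun v => PK k S v * PK k T v := by
  subst hU
  funext v
  exact PK_union h v

theorem PK_singleton {k : I → (∀ i, α i) → ℝ} (i : I) (v : ∀ i, α i) :
    PK k {i} v = k i v := by
  unfold PK
  simp

theorem PK_pos {k : I → (∀ i, α i) → ℝ} (hk : ∀ i v, 0 < k i v) (S : Set I) (v : ∀ i, α i) :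
    0 < PK k S v := by
  unfold PK
  refine Finset.prod_pos fun i _ => ?_
  split_ifs
  · exact hk i v
  · exact one_pos

theorem PK_dep {k : I → (∀ i, α i) → ℝ} {E : I → I → Prop} {S U : Set I}
    (hk : ∀ i, DepOn (k i) (insert i {j | E j i}))
    (h : ∀ i ∈ S, insert i {j | E j i} ⊆ U) : DepOn (PK k S) U := by
  intro v w hvw
  unfold PK
  refine Finset.prod_congr rfl fun i _ => ?_
  split_ifs with hi
  · exact hk i v w fun j hj => hvw j (h i hi hj)
  · rfl

/-- A positive kernel family for the graph `E`. -/
structure IsKer (E : I → I → Prop) (k : I → (∀ i, α i) → ℝ) : Prop where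
  pos : ∀ i v, 0 < k i v
  dep : ∀ i, DepOn (k i) (insert i {j | E j i})
  sum : ∀ i v, Mg {i} (k i) v = 1

theorem exists_sink {E : I → I → Prop} (hdag : Irreflexive (Relation.TransGen E))
    (D : Set I) (hD : D.Nonempty) : ∃ i ∈ D, ∀ j ∈ D, ¬ E i j := by
  have : IsTrans I (fun a b => Relation.TransGen E b a) := ⟨fun a b c h1 h2 => h2.trans h1⟩
  have : Std.Irrefl (fun a b => Relation.TransGen E b a) := ⟨fun a h => hdag a h⟩
  have wf := Finite.wellFounded_of_trans_of_irrefl (fun a b : I => Relation.TransGen E b a)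
  obtain ⟨i, hi, hmin⟩ := wf.has_min D hD
  exact ⟨i, hi, fun j hj hij => hmin j hj (Relation.TransGen.single hij)⟩

theorem Mg_PK_one {E : I → I → Prop} (hdag : Irreflexive (Relation.TransGen E))
    {k : I → (∀ i, α i) → ℝ} (hk : IsKer E k) (D : Set I) (v : ∀ i, α i) :
    Mg D (PK k D) v = 1 := by
  have key : ∀ n : ℕ, ∀ D : Set I, D.ncard = n → ∀ v, Mg D (PK k D) v = 1 := by
    intro n
    induction n with
    | zero =>
      intro D hD v
      rw [Set.ncard_eq_zero (Set.toFinite D)] at hD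
      subst hD
      rw [Mg_empty]
      simp [PK]
    | succ n ih =>
      intro D hD v
      obtain ⟨i, hi, hs⟩ := exists_sink hdag D (by
        rw [← Set.ncard_pos (Set.toFinite D)]; omega)
      have hdis : Disjoint (D \ {i}) {i} := Set.disjoint_sdiff_left
      have hun : D = D \ {i} ∪ {i} := by simp [hi]
      have hc : (D \ {i}).ncard = n := by
        rw [Set.ncard_sdiff_singleton_of_mem hi]; omega
      conv_lhs => rw [hun]
      rw [← Mg_Mg hdis]
      rw [← ih _ hc v]
      apply Mg_congr
      intro w _
      rw [PK_split hdis rfl, Mg_mul_left (S := {i}ᶜ) w]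
      · have : PK k {i} = k i := funext (PK_singleton i)
        rw [this, hk.sum, mul_one]
      · apply PK_dep hk.dep
        rintro j ⟨hj, hji⟩ l hl
        rcases hl with rfl | hl
        · exact hji
        · rintro rfl
          exact hs j hj hl
      · exact Set.disjoint_left.2 fun a ha hb => ha hb
  exact key _ D rfl v

/-- Summing out a set `D` of coordinates with all its kernels. -/
theorem Mg_PK_out {E : I → I → Prop} (hdag : Irreflexive (Relation.TransGen E))
    {k : I → (∀ i, α i) → ℝ} (hk : IsKer E k) {B D S : Set I} (hBD : Disjoint B D)
    (hSD : Disjoint S D) {F : (∀ i, α i) → ℝ} (hF : DepOn F S) (v : ∀ i, α i) :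
    Mg (B ∪ D) (fun w => F w * PK k D w) v = Mg B F v := by
  rw [← Mg_Mg hBD]
  apply Mg_congr
  intro w _
  rw [Mg_mul_left w hF hSD, Mg_PK_one hdag hk, mul_one]


theorem acyc_ne {E : I → I → Prop} (hdag : Irreflexive (Relation.TransGen E)) {i j : I}
    (h : E i j) : i ≠ j := by
  rintro rfl
  exact hdag i (Relation.TransGen.single h)

theorem condPr_sum {E : I → I → Prop} (hdag : Irreflexive (Relation.TransGen E))
    {q : (∀ i, α i) → ℝ} (hpos : ∀ v, 0 < q v) (i : I) (v : ∀ i, α i) :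
    Mg {i} (condPr q {i} {j | E j i}) v = 1 := by
  have hi : i ∉ {j | E j i} := fun h => acyc_ne hdag h rfl
  have h1 : condPr q {i} {j | E j i} = fun w =>
      (Mg {j | E j i}ᶜ q w)⁻¹ * Mg ({i} ∪ {j | E j i})ᶜ q w := by
    funext w
    unfold condPr
    rw [prS_eq, prS_eq, div_eq_inv_mul]
  have hdep : DepOn (fun w => (Mg {j | E j i}ᶜ q w)⁻¹) {j | E j i} := by
    intro a b hab
    have : DepOn (Mg {j | E j i}ᶜ q) (Set.univ \ {j | E j i}ᶜ) :=
      DepOn_Mg (fun a b h => by rw [funext fun i => h i trivial])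
    show (Mg {j | E j i}ᶜ q a)⁻¹ = (Mg {j | E j i}ᶜ q b)⁻¹
    rw [this a b (fun j hj => hab j (by simpa using hj))]
  rw [h1, Mg_mul_left v hdep (by simpa using hi), Mg_Mg]
  · have : ({i} ∪ ({i} ∪ {j | E j i})ᶜ : Set I) = {j | E j i}ᶜ := by
      ext j
      by_cases hj : j = i
      · subst hj; simpa using hi
      · simp [hj]
    rw [this, inv_mul_cancel₀]
    exact (Mg_pos v hpos).ne'
  · simp

theorem ker_of_markov {E : I → I → Prop} (hdag : Irreflexive (Relation.TransGen E))
    {q : (∀ i, α i) → ℝ} (hpos : ∀ v, 0 < q v) (hm : MarkovCompat q E) :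
    IsKer E (fun i => condPr q {i} {j | E j i}) ∧
      q = PK (fun i => condPr q {i} {j | E j i}) Set.univ := by
  refine ⟨⟨?_, ?_, ?_⟩, ?_⟩
  · intro i v
    unfold condPr
    rw [prS_eq, prS_eq]
    exact div_pos (Mg_pos v hpos) (Mg_pos v hpos)
  · intro i a b hab
    unfold condPr
    have key : ∀ S : Set I, S ⊆ insert i {j | E j i} → prS q S a = prS q S b := by
      intro S hS
      rw [prS_eq, prS_eq]
      have : DepOn (Mg Sᶜ q) (Set.univ \ Sᶜ) :=
        DepOn_Mg (fun a b h => by rw [funext fun i => h i trivial])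
      exact this a b fun j hj => hab j (hS (by simpa using hj))
    rw [key _ (by intro j; simp), key _ (by intro j; simp; tauto)]
  · intro i v
    exact condPr_sum hdag hpos i v
  · funext v
    rw [hm v, finprod_eq_prod_of_fintype]
    simp [PK]

theorem desc_closed {E : I → I → Prop} {X : Set I} {i j : I} (h : E i j)
    (hi : i ∈ descendants E X) : j ∈ descendants E X := by
  obtain ⟨s, hs, ha⟩ := hi
  exact ⟨s, hs, Relation.ReflTransGen.tail ha h⟩

theorem sub_desc {E : I → I → Prop} {X : Set I} : X ⊆ descendants E X :=
  fun x hx => ⟨x, hx, Relation.ReflTransGen.refl⟩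

/-- Marginals of non-descendants of `X` do not depend on the kernels of `X`. -/
theorem marg_nd {E : I → I → Prop} (hdag : Irreflexive (Relation.TransGen E))
    {k : I → (∀ i, α i) → ℝ} (hk : IsKer E k) {X Z S : Set I} {e : (∀ i, α i) → ℝ}
    (hZ : Disjoint Z (descendants E X)) (he : DepOn e S) (hS : Disjoint S (descendants E X))
    (v : ∀ i, α i) :
    Mg Zᶜ (fun w => e w * PK k Set.univ w) v = Mg (X ∪ Z)ᶜ (fun w => e w * PK k Xᶜ w) v := by
  set D := descendants E X with hD
  have hXD : X ⊆ D := sub_desc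
  have hZD : ∀ i ∈ Z, i ∉ D := fun i hi => Set.disjoint_left.1 hZ hi
  have e1 : Zᶜ = (Z ∪ D)ᶜ ∪ D := by
    ext i
    simp only [Set.mem_compl_iff, Set.mem_union]
    have := hZD i
    tauto
  have e2 : (X ∪ Z)ᶜ = (Z ∪ D)ᶜ ∪ (D \ X) := by
    ext i
    simp only [Set.mem_compl_iff, Set.mem_union, Set.mem_sdiff]
    have := hZD i
    have := @hXD i
    tauto
  have hF : DepOn (fun w => e w * PK k Dᶜ w) Dᶜ := by
    refine DepOn.mul (he.mono ?_) (PK_dep hk.dep ?_)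
    · intro i hi; exact Set.disjoint_left.1 hS hi
    · intro i hi j hj
      rcases hj with rfl | hj
      · exact hi
      · exact fun h => hi (desc_closed hj h)
  have e3 : (fun w => e w * PK k Set.univ w) = fun w => (e w * PK k Dᶜ w) * PK k D w := by
    funext w
    rw [PK_split (S := Dᶜ) (T := D) (U := Set.univ) disjoint_compl_left (by simp)]
    ring
  have e4 : (fun w => e w * PK k Xᶜ w) = fun w => (e w * PK k Dᶜ w) * PK k (D \ X) w := by
    funext w
    rw [PK_split (S := Dᶜ) (T := D \ X) (U := Xᶜ)]
    · ring
    · exact disjoint_compl_left.mono_right Set.sdiff_subset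
    · ext i
      simp only [Set.mem_compl_iff, Set.mem_union, Set.mem_sdiff]
      have := @hXD i
      tauto
  have d1 : Disjoint (Z ∪ D)ᶜ D := Set.disjoint_left.2 fun i hi h => hi (Or.inr h)
  rw [e1, e2, e3, e4, Mg_PK_out hdag hk d1 disjoint_compl_left hF]
  have := Mg_PK_one hdag hk (D \ X)
  rw [← Mg_Mg (d1.mono_right Set.sdiff_subset)]
  apply Mg_congr
  intro w _
  rw [Mg_mul_left w hF (disjoint_compl_left.mono_right Set.sdiff_subset), this, mul_one]

theorem prS_pos {q : (∀ i, α i) → ℝ} (hpos : ∀ v, 0 < q v) (S : Set I) (v : ∀ i, α i) :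
    0 < prS q S v := by
  rw [prS_eq]
  exact Mg_pos v hpos

theorem condPr_ker {E : I → I → Prop} (hdag : Irreflexive (Relation.TransGen E))
    {k : I → (∀ i, α i) → ℝ} (hk : IsKer E k) (i : I) (v : ∀ i, α i) :
    condPr (PK k Set.univ) {i} {j | E j i} v = k i v := by
  unfold condPr
  rw [div_eq_iff (prS_pos (PK_pos hk.pos _) _ _).ne', prS_eq, prS_eq]
  have hpa : Disjoint {j | E j i} (descendants E {i}) := by
    rw [Set.disjoint_left]
    rintro j hj ⟨s, rfl, ha⟩
    exact hdag j (Relation.TransGen.head' hj ha)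
  have h1 := marg_nd hdag hk (X := {i}) (S := ∅) (e := fun _ => 1) hpa
    (fun _ _ _ => rfl) (by simp) v
  simp only [one_mul] at h1
  have e0 : (fun w => PK k Set.univ w) = PK k Set.univ := rfl
  have e0' : (fun w => PK k {i}ᶜ w) = PK k {i}ᶜ := rfl
  rw [e0, e0'] at h1
  rw [h1, PK_split (S := {i}) (T := {i}ᶜ) (U := Set.univ) disjoint_compl_right (by simp)]
  have : PK k {i} = k i := funext (PK_singleton i)
  rw [this, Mg_mul_left v (hk.dep i)]
  exact Set.disjoint_left.2 fun j hj h => h (by simpa using hj)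

theorem markov_of_ker {E : I → I → Prop} (hdag : Irreflexive (Relation.TransGen E))
    {k : I → (∀ i, α i) → ℝ} (hk : IsKer E k) :
    IsPMF (PK k Set.univ) ∧ (∀ v, 0 < PK k Set.univ v) ∧ MarkovCompat (PK k Set.univ) E := by
  refine ⟨⟨fun v => (PK_pos hk.pos _ v).le, ?_⟩, PK_pos hk.pos _, ?_⟩
  · rw [finsum_eq_sum_of_fintype, ← Mg_univ _ (fun i => Classical.arbitrary _)]
    exact Mg_PK_one hdag hk _ _
  · intro v
    rw [finprod_eq_prod_of_fintype]
    simp only [condPr_ker hdag hk]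
    simp [PK]

theorem do_eq {E : I → I → Prop} {q : (∀ i, α i) → ℝ} {k : I → (∀ i, α i) → ℝ}
    (hq : ∀ i v, condPr q {i} {j | E j i} v = k i v) (X Y : Set I) (x y v0 : ∀ i, α i)
    (hx : ∀ i ∈ X, v0 i = x i) (hy : ∀ i ∈ Y, v0 i = y i) :
    (∑ᶠ v ∈ {v : ∀ i, α i | ∀ i ∈ Y, v i = y i}, doPMF q E X x v) =
      Mg (X ∪ Y)ᶜ (PK k Xᶜ) v0 := by
  rw [finsum_eq_sum_of_fintype]
  unfold Mg
  refine Finset.sum_congr rfl fun v _ => ?_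
  rw [finsum_eq_if]
  unfold doPMF
  have hprod : (∏ᶠ i ∈ Xᶜ, condPr q {i} {j | E j i} v) = PK k Xᶜ v := by
    rw [finprod_eq_prod_of_fintype]
    unfold PK
    refine Finset.prod_congr rfl fun i _ => ?_
    rw [finprod_eq_if, hq]
    split_ifs <;> rfl
  rw [hprod, ← ite_and]
  have hiff : ((v ∈ {v : ∀ i, α i | ∀ i ∈ Y, v i = y i}) ∧ ∀ i ∈ X, v i = x i) ↔
      ∀ i, i ∉ (X ∪ Y)ᶜ → v i = v0 i := by
   refine ⟨fun h i hi => ?_, fun h => ⟨fun i hi => ?_, fun i hi => ?_⟩⟩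
   · simp only [Set.mem_compl_iff, not_not] at hi
     rcases hi with hi | hi
     · rw [h.2 i hi, hx i hi]
     · rw [h.1 i hi, hy i hi]
   · rw [h i (by simp [hi]), hy i hi]
   · rw [h i (by simp [hi]), hx i hi]
  by_cases h : ∀ i, i ∉ (X ∪ Y)ᶜ → v i = v0 i
  · rw [if_pos (hiff.2 h), if_pos h]
  · rw [if_neg (fun h' => h (hiff.1 h')), if_neg h]

theorem merge_sum (X Z : Set I) (x y : ∀ i, α i) (F : (∀ i, α i) → ℝ) :
    ∑ᶠ z : (∀ j : Z, α j.1), F (mergeVals X Z x z y) =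
      Mg Z F (fun i => if i ∈ X then x i else y i) := by
  rw [finsum_eq_sum_of_fintype, Mg_eq_filter]
  refine Finset.sum_bij (fun z _ => mergeVals X Z x z y) ?_ ?_ ?_ ?_
  · intro z _
    simp only [Finset.mem_filter, Finset.mem_univ, true_and]
    intro i hi
    simp [mergeVals, hi]
  · intro z _ z' _ h
    funext j
    have := congrFun h j.1
    simpa [mergeVals] using this
  · intro w hw
    simp only [Finset.mem_filter, Finset.mem_univ, true_and] at hw
    refine ⟨fun j => w j.1, Finset.mem_univ _, ?_⟩
    funext i
    by_cases hi : i ∈ Z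
    · simp [mergeVals, hi]
    · simp [mergeVals, hi, hw i hi]
  · intro z _; rfl


/-- Both vertices lie outside `S` and in the scope of a common factor. -/
def MStep (E : I → I → Prop) (Fc S : Set I) (u u' : I) : Prop :=
  u ∉ S ∧ u' ∉ S ∧ ∃ c ∈ Fc, (u = c ∨ E u c) ∧ (u' = c ∨ E u' c)

def MConn (E : I → I → Prop) (Fc S : Set I) (u u' : I) : Prop :=
  Relation.ReflTransGen (MStep E Fc S) u u'

def AncS (E : I → I → Prop) (S : Set I) : Set I := {a | ∃ s ∈ S, Anc E a s}

def AdjSep (E : I → I → Prop) (X : Set I) (y : I) (Z : Set I) : Prop :=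
  ∀ x ∈ X, ∀ P, E P x → ¬ MConn E (AncS E (X ∪ Z ∪ {y}) \ X) (X ∪ Z) y P

theorem AncS_closed {E : I → I → Prop} {S : Set I} {i j : I} (h : E i j)
    (hj : j ∈ AncS E S) : i ∈ AncS E S := by
  obtain ⟨s, hs, ha⟩ := hj
  exact ⟨s, hs, Relation.ReflTransGen.head h ha⟩

theorem sub_AncS {E : I → I → Prop} {S : Set I} : S ⊆ AncS E S :=
  fun x hx => ⟨x, hx, Relation.ReflTransGen.refl⟩

theorem MConn_notMem {E : I → I → Prop} {Fc S : Set I} {y u : I} (hy : y ∉ S)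
    (h : MConn E Fc S y u) : u ∉ S := by
  rcases Relation.ReflTransGen.cases_tail h with h | ⟨c, _, h⟩
  · rwa [h]
  · exact h.2.1

theorem MConn_mem {E : I → I → Prop} {Fc S A : Set I} {y u : I} (hy : y ∈ A)
    (hFA : ∀ c ∈ Fc, c ∈ A) (hA : ∀ i j, E i j → j ∈ A → i ∈ A)
    (h : MConn E Fc S y u) : u ∈ A := by
  rcases Relation.ReflTransGen.cases_tail h with h | ⟨c, _, h⟩
  · rwa [h]
  · obtain ⟨_, _, c, hc, _, h | h⟩ := h
    · rw [h]; exact hFA c hc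
    · exact hA _ _ h (hFA c hc)

/-- The factors in `Fc` whose scope meets `C`. -/
def FC (E : I → I → Prop) (Fc C : Set I) : Set I :=
  {i ∈ Fc | ∃ u ∈ C, u = i ∨ E u i}

theorem depF {E : I → I → Prop} {k : I → (∀ i, α i) → ℝ} (hk : IsKer E k)
    {Fc S : Set I} {y : I} (hy : y ∉ S) :
    DepOn (PK k (FC E Fc {u | MConn E Fc S y u})) ({u | MConn E Fc S y u} ∪ S) := by
  apply PK_dep hk.dep
  rintro i ⟨hi, u, hu, hui⟩ j hj
  by_cases hjS : j ∈ S
  · exact Or.inr hjS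
  · left
    exact Relation.ReflTransGen.tail hu ⟨MConn_notMem hy hu, hjS, i, hi, hui, hj⟩

theorem depG {E : I → I → Prop} {k : I → (∀ i, α i) → ℝ} (hk : IsKer E k)
    {Fc C : Set I} : DepOn (PK k (Fc \ FC E Fc C)) Cᶜ := by
  apply PK_dep hk.dep
  rintro i ⟨hi, hn⟩ j hj hjC
  exact hn ⟨hi, j, hjC, hj⟩

theorem soundness {E : I → I → Prop} (hdag : Irreflexive (Relation.TransGen E))
    {X Z : Set I} {y : I} (hyX : y ∉ X) (hyZ : y ∉ Z)
    (hZ : Disjoint Z (descendants E X)) (hsep : AdjSep E X y Z) :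
    IsAdjustmentSet (α := α) E X {y} Z := by
  intro q hpmf hpos hm x yv
  obtain ⟨hk, hq⟩ := ker_of_markov hdag hpos hm
  set k := fun i => condPr q {i} {j | E j i} with hkdef
  set v0 : ∀ i, α i := fun i => if i ∈ X then x i else yv i with hv0
  rw [do_eq (k := k) (fun i v => rfl) X {y} x yv v0 (fun i hi => by simp [hv0, hi])
    (fun i hi => by
      have : i ∉ X := by rw [Set.mem_singleton_iff.1 hi]; exact hyX
      simp [hv0, this])]
  rw [merge_sum X Z x yv (fun w => condPr q {y} (X ∪ Z) w * prS q Z w)]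
  set A := AncS E (X ∪ Z ∪ {y}) with hA
  have hXA : ∀ i ∈ X, i ∈ A := fun i hi => sub_AncS (by simp [hi])
  have hZA : ∀ i ∈ Z, i ∈ A := fun i hi => sub_AncS (by simp [hi])
  have hyA : y ∈ A := sub_AncS (by simp)
  have hXZ : ∀ i ∈ X, i ∉ Z := fun i hi hz => Set.disjoint_left.1 hZ hz (sub_desc hi)
  have hyS : y ∉ X ∪ Z := by simp [hyX, hyZ]
  set C := {u | MConn E (A \ X) (X ∪ Z) y u} with hC
  have hyC : y ∈ C := Relation.ReflTransGen.refl
  have hCS : ∀ u ∈ C, u ∉ X ∪ Z := fun u hu => MConn_notMem hyS hu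
  have hCA : ∀ u ∈ C, u ∈ A := fun u hu =>
    MConn_mem hyA (fun c hc => hc.1) (fun i j h => AncS_closed h) hu
  set N := A \ (X ∪ Z ∪ C) with hN
  set F := PK k (FC E (A \ X) C) with hF
  set G := PK k ((A \ X) \ FC E (A \ X) C) with hG
  set H := PK k X with hH
  have dF : DepOn F (C ∪ (X ∪ Z)) := depF hk hyS
  have dG : DepOn G Cᶜ := depG hk
  have dH : DepOn H Cᶜ := by
    apply PK_dep hk.dep
    rintro i hi j (rfl | hj) hjC
    · exact hCS j hjC (Or.inl hi)
    · exact hsep i hi j hj hjC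
  have dGH : DepOn (fun w => G w * H w) Cᶜ := dG.mul dH
  have hAF : PK k (A \ X) = fun w => F w * G w :=
    PK_split Set.disjoint_sdiff_right (by
      ext i
      simp only [Set.mem_union, Set.mem_sdiff, FC, Set.mem_setOf_eq]
      tauto)
  have hAA : PK k A = fun w => F w * (G w * H w) := by
    rw [PK_split (S := A \ X) (T := X) (U := A) Set.disjoint_sdiff_left (by
      ext i
      simp only [Set.mem_union, Set.mem_sdiff]
      have := hXA i
      tauto), hAF]
    funext w
    ring
  have dAp : ∀ S : Set I, S ⊆ A → DepOn (PK k S) A := by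
    intro S hS
    apply PK_dep hk.dep
    rintro i hi j (rfl | hj)
    · exact hS hi
    · exact AncS_closed hj (hS hi)
  have hqA : ∀ B : Set I, B ⊆ A → ∀ w, Mg (B ∪ Aᶜ) q w = Mg B (PK k A) w := by
    intro B hB w
    have : q = fun w => PK k A w * PK k Aᶜ w := by
      conv_lhs => rw [hq]
      exact PK_split disjoint_compl_right (by simp)
    have hd : Disjoint B Aᶜ := Set.disjoint_left.2 fun i hi h => h (hB hi)
    rw [this, Mg_PK_out hdag hk hd
      disjoint_compl_right (dAp A subset_rfl)]
  have hXc : ∀ B : Set I, B ⊆ A → ∀ w, Mg (B ∪ Aᶜ) (PK k Xᶜ) w = Mg B (PK k (A \ X)) w := by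
    intro B hB w
    have : PK k Xᶜ = fun w => PK k (A \ X) w * PK k Aᶜ w :=
      PK_split (disjoint_compl_right.mono_left Set.sdiff_subset) (by
        ext i
        simp only [Set.mem_union, Set.mem_sdiff, Set.mem_compl_iff]
        have := hXA i
        tauto)
    have hd : Disjoint B Aᶜ := Set.disjoint_left.2 fun i hi h => h (hB hi)
    rw [this, Mg_PK_out hdag hk hd
      disjoint_compl_right (dAp _ Set.sdiff_subset)]
  have hNA : N ⊆ A := Set.sdiff_subset
  have hNC : Disjoint C N := Set.disjoint_left.2 fun i hi h => h.2 (Or.inr hi)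
  have dFN : Disjoint (C ∪ (X ∪ Z)) N := Set.disjoint_left.2 fun i hi h => h.2 (by
    rcases hi with hi | hi
    · exact Or.inr hi
    · exact Or.inl hi)
  have hsub : ∀ B : Set I, B ⊆ C → B ∪ N ⊆ A := by
    rintro B hB i (hi | hi)
    · exact hCA i (hB hi)
    · exact hNA hi
  have p1 : ∀ B : Set I, B ⊆ C → ∀ w, Mg (B ∪ N ∪ Aᶜ) q w =
      Mg B F w * Mg N (fun w => G w * H w) w := by
    intro B hB w
    rw [hqA _ (hsub B hB), hAA, Mg_mul w (hNC.mono_left hB) dF dGH dFN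
      (disjoint_compl_left.mono_right hB)]
  have p2 : ∀ B : Set I, B ⊆ C → ∀ w, Mg (B ∪ N) (PK k (A \ X)) w =
      Mg B F w * Mg N G w := by
    intro B hB w
    rw [hAF, Mg_mul w (hNC.mono_left hB) dF dG dFN
      (disjoint_compl_left.mono_right hB)]
  have hset : ∀ i, (i ∈ C → i ∉ X ∧ i ∉ Z ∧ i ∈ A) ∧ (i ∈ X → i ∈ A ∧ i ∉ Z) ∧
      (i ∈ Z → i ∈ A) ∧ (i = y → i ∈ C) := by
    intro i
    refine ⟨fun h => ⟨fun h' => hCS i h (Or.inl h'), fun h' => hCS i h (Or.inr h'), hCA i h⟩,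
      fun h => ⟨hXA i h, hXZ i h⟩, hZA i, ?_⟩
    rintro rfl
    exact hyC
  have s1 : ({y} ∪ (X ∪ Z))ᶜ = (C \ {y}) ∪ N ∪ Aᶜ := by
    ext i
    simp only [Set.mem_union, Set.mem_sdiff, Set.mem_compl_iff, Set.mem_singleton_iff, hN]
    have h1 := hset i
    clear * - h1
    grind
  have s2 : (X ∪ Z)ᶜ = C ∪ N ∪ Aᶜ := by
    ext i
    simp only [Set.mem_union, Set.mem_sdiff, Set.mem_compl_iff, hN]
    have h1 := hset i
    clear * - h1
    grind
  have s3 : (X ∪ {y})ᶜ = (Z ∪ ((C \ {y}) ∪ N)) ∪ Aᶜ := by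
    ext i
    simp only [Set.mem_union, Set.mem_sdiff, Set.mem_compl_iff, Set.mem_singleton_iff, hN]
    have h1 := hset i
    have h2 : i = y → i ∉ Z := by rintro rfl; exact hyZ
    clear * - h1 h2
    grind
  have hdis : Disjoint Z ((C \ {y}) ∪ N) := by
    rw [Set.disjoint_left]
    rintro i hi (h | h)
    · exact hCS i h.1 (Or.inr hi)
    · exact h.2 (Or.inl (Or.inr hi))
  rw [s3, hXc _ (Set.union_subset hZA (hsub _ Set.sdiff_subset)), ← Mg_Mg hdis]
  apply Mg_congr
  intro w _
  have hFpos : 0 < Mg C F w := Mg_pos w (PK_pos hk.pos _)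
  have hGHpos : 0 < Mg N (fun w => G w * H w) w :=
    Mg_pos w (fun w => mul_pos (PK_pos hk.pos _ w) (PK_pos hk.pos _ w))
  have hz := marg_nd hdag hk (X := X) (S := ∅) (e := fun _ => 1) hZ
    (fun _ _ _ => rfl) (by simp) w
  simp only [one_mul] at hz
  have e0 : (fun w => PK k Set.univ w) = q := hq.symm
  have e0' : (fun w => PK k Xᶜ w) = PK k Xᶜ := rfl
  rw [e0, e0', s2, hXc _ (hsub C subset_rfl), p2 C subset_rfl] at hz
  unfold condPr
  rw [prS_eq, prS_eq, prS_eq, s1, s2, p1 _ Set.sdiff_subset, p1 C subset_rfl, hz,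
    p2 _ Set.sdiff_subset]
  field_simp

/-- Global Markov property in moral form. -/
theorem global_markov {E : I → I → Prop} (hdag : Irreflexive (Relation.TransGen E))
    {q : (∀ i, α i) → ℝ} (hpos : ∀ v, 0 < q v) (hm : MarkovCompat q E)
    {a b : I} {S : Set I} (haS : a ∉ S) (hbS : b ∉ S)
    (hsep : ¬ MConn E (AncS E ({a, b} ∪ S)) S a b) : CondIndep q {a} {b} S := by
  intro x
  obtain ⟨hk, hq⟩ := ker_of_markov hdag hpos hm
  set k := fun i => condPr q {i} {j | E j i} with hkdef
  set A := AncS E ({a, b} ∪ S) with hA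
  have haA : a ∈ A := sub_AncS (by simp)
  have hbA : b ∈ A := sub_AncS (by simp)
  have hSA : ∀ i ∈ S, i ∈ A := fun i hi => sub_AncS (by simp [hi])
  set C := {u | MConn E A S a u} with hC
  have haC : a ∈ C := Relation.ReflTransGen.refl
  have hbC : b ∉ C := hsep
  have hCS : ∀ u ∈ C, u ∉ S := fun u hu => MConn_notMem haS hu
  have hCA : ∀ u ∈ C, u ∈ A := fun u hu =>
    MConn_mem haA (fun c hc => hc) (fun i j h => AncS_closed h) hu
  set N := A \ (S ∪ C) with hN
  set F := PK k (FC E A C) with hF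
  set G := PK k (A \ FC E A C) with hG
  have dF : DepOn F (C ∪ S) := depF hk haS
  have dG : DepOn G Cᶜ := depG hk
  have hAA : PK k A = fun w => F w * G w :=
    PK_split Set.disjoint_sdiff_right (by
      ext i
      simp only [Set.mem_union, Set.mem_sdiff, FC, Set.mem_setOf_eq]
      tauto)
  have dAp : DepOn (PK k A) A := by
    apply PK_dep hk.dep
    rintro i hi j (rfl | hj)
    · exact hi
    · exact AncS_closed hj hi
  have hNC : Disjoint C N := Set.disjoint_left.2 fun i hi h => h.2 (Or.inr hi)
  have dFN : Disjoint (C ∪ S) N := Set.disjoint_left.2 fun i hi h => h.2 (by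
    rcases hi with hi | hi
    · exact Or.inr hi
    · exact Or.inl hi)
  have p1 : ∀ B : Set I, B ⊆ C → ∀ B' : Set I, B' ⊆ N → Mg (B ∪ B' ∪ Aᶜ) q x =
      Mg B F x * Mg B' G x := by
    intro B hB B' hB'
    have : q = fun w => PK k A w * PK k Aᶜ w := by
      conv_lhs => rw [hq]
      exact PK_split disjoint_compl_right (by simp)
    have hd : Disjoint (B ∪ B') Aᶜ := Set.disjoint_left.2 fun i hi h => h (by
      rcases hi with hi | hi
      · exact hCA i (hB hi)
      · exact (hB' hi).1)
    rw [this, Mg_PK_out hdag hk hd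
      disjoint_compl_right dAp, hAA, Mg_mul x ((hNC.mono_left hB).mono_right hB') dF dG
      (dFN.mono_right hB')
      (disjoint_compl_left.mono_right hB)]
  have hset : ∀ i, (i ∈ C → i ∉ S ∧ i ∈ A) ∧ (i ∈ S → i ∈ A) ∧ (i = a → i ∈ C) ∧
      (i = b → i ∈ A ∧ i ∉ C ∧ i ∉ S) := by
    intro i
    refine ⟨fun h => ⟨hCS i h, hCA i h⟩, hSA i, ?_, ?_⟩
    · rintro rfl; exact haC
    · rintro rfl; exact ⟨hbA, hbC, hbS⟩
  have s1 : ({a} ∪ {b} ∪ S)ᶜ = (C \ {a}) ∪ (N \ {b}) ∪ Aᶜ := by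
    ext i
    simp only [Set.mem_union, Set.mem_sdiff, Set.mem_compl_iff, Set.mem_singleton_iff, hN]
    have h1 := hset i
    clear * - h1
    grind
  have s2 : Sᶜ = C ∪ N ∪ Aᶜ := by
    ext i
    simp only [Set.mem_union, Set.mem_sdiff, Set.mem_compl_iff, hN]
    have h1 := hset i
    clear * - h1
    grind
  have s3 : ({a} ∪ S)ᶜ = (C \ {a}) ∪ N ∪ Aᶜ := by
    ext i
    simp only [Set.mem_union, Set.mem_sdiff, Set.mem_compl_iff, Set.mem_singleton_iff, hN]
    have h1 := hset i
    clear * - h1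
    grind
  have s4 : ({b} ∪ S)ᶜ = C ∪ (N \ {b}) ∪ Aᶜ := by
    ext i
    simp only [Set.mem_union, Set.mem_sdiff, Set.mem_compl_iff, Set.mem_singleton_iff, hN]
    have h1 := hset i
    clear * - h1
    grind
  have hFpos : 0 < Mg C F x := Mg_pos x (PK_pos hk.pos _)
  have hGpos : 0 < Mg N G x := Mg_pos x (PK_pos hk.pos _)
  unfold condPr
  simp only [prS_eq]
  rw [s1, s2, s3, s4, p1 _ Set.sdiff_subset _ Set.sdiff_subset, p1 C subset_rfl N subset_rfl,
    p1 _ Set.sdiff_subset _ subset_rfl, p1 _ subset_rfl _ Set.sdiff_subset]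
  field_simp


/-- Bayes-ball reachability: `BB E S a d u` means an open walk from `a` to `u`, whose last edge
points into `u` iff `d = true`. -/
inductive BB (E : I → I → Prop) (S : Set I) (a : I) : Bool → I → Prop
  | startOut {v} : E a v → BB E S a true v
  | startIn {v} : E v a → BB E S a false v
  | out {d u v} : BB E S a d u → u ∉ S → E u v → BB E S a true v
  | chain {u v} : BB E S a false u → u ∉ S → E v u → BB E S a false v
  | coll {u v} : BB E S a true u → u ∈ AncS E S → E v u → BB E S a false v

theorem BB_directed {E : I → I → Prop} {S : Set I} {a c b : I} (h : BB E S a true c)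
    (hc : c ∉ AncS E S) (hcb : Anc E c b) : BB E S a true b := by
  have : BB E S a true b ∧ b ∉ AncS E S ∨ b ∈ AncS E S ∨ BB E S a true b := by
    induction hcb with
    | refl => exact Or.inl ⟨h, hc⟩
    | tail hcu huv ih => 
      rename_i u v
      have hu : BB E S a true u ∧ u ∉ AncS E S ∨ u ∈ AncS E S ∨ BB E S a true u := ih
      have hnu : u ∉ AncS E S := by
        rintro ⟨s, hs, hus⟩
        exact hc ⟨s, hs, hcu.trans hus⟩
      have : BB E S a true u := by tauto
      exact Or.inr (Or.inr (this.out (fun h => hnu (sub_AncS h)) huv))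
  have hnb : b ∉ AncS E S := by
    rintro ⟨s, hs, hus⟩
    exact hc ⟨s, hs, hcb.trans hus⟩
  tauto

theorem BB_back {E : I → I → Prop} {S : Set I} {a c : I}
    (hc : c ∉ AncS E S) (hca : Anc E c a) : c = a ∨ BB E S a false c := by
  induction hca using Relation.ReflTransGen.head_induction_on with
  | refl => exact Or.inl rfl
  | head huv hva ih =>
    rename_i u v
    have hv : v ∉ AncS E S := fun h => hc (AncS_closed huv h)
    rcases ih hv with rfl | h
    · exact Or.inr (BB.startIn huv)
    · exact Or.inr (h.chain (fun h => hv (sub_AncS h)) huv)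

theorem BB_in {E : I → I → Prop} {S : Set I} {a b c u : I}
    (hc : c ∈ AncS E ({a, b} ∪ S)) (h : c = a ∨ BB E S a true c ∨ (c ∉ S ∧ BB E S a false c))
    (huc : E u c) : (BB E S a false u) ∨ BB E S a true b := by
  rcases h with rfl | h | ⟨hn, h⟩
  · exact Or.inl (BB.startIn huc)
  · by_cases hcS : c ∈ AncS E S
    · exact Or.inl (h.coll hcS huc)
    · obtain ⟨s, hs, hcs⟩ := hc
      rcases hs with (rfl | rfl) | hs
      · rcases BB_back hcS hcs with rfl | h
        · exact Or.inl (BB.startIn huc)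
        · exact Or.inl (h.chain (fun h => hcS (sub_AncS h)) huc)
      · exact Or.inr (BB_directed h hcS hcs)
      · exact absurd ⟨s, hs, hcs⟩ hcS
  · exact Or.inl (h.chain hn huc)

theorem BB_of_MConn {E : I → I → Prop} {S : Set I} {a b : I} (hab : a ≠ b)
    (h : MConn E (AncS E ({a, b} ∪ S)) S a b) : ∃ d, BB E S a d b := by
  have key : ∀ u, MConn E (AncS E ({a, b} ∪ S)) S a u →
      (u = a ∨ ∃ d, BB E S a d u) ∨ ∃ d, BB E S a d b := by
    intro u hu
    induction hu with
    | refl => exact Or.inl (Or.inl rfl)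
    | tail hpre hst ih =>
      rename_i u v
      rcases ih with ih | ih
      swap
      · exact Or.inr ih
      obtain ⟨huS, hvS, c, hc, h1, h2⟩ := hst
      have hout : ∀ w, E u w → BB E S a true w := by
        intro w hw
        rcases ih with rfl | ⟨d, hd⟩
        · exact BB.startOut hw
        · exact hd.out huS hw
      rcases h1 with rfl | h1
      · rcases h2 with rfl | h2
        · exact Or.inl ih
        · have : u = a ∨ BB E S a true u ∨ (u ∉ S ∧ BB E S a false u) := by
            rcases ih with h | ⟨d, hd⟩
            · exact Or.inl h
            · cases d
              · exact Or.inr (Or.inr ⟨huS, hd⟩)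
              · exact Or.inr (Or.inl hd)
          rcases BB_in hc this h2 with h | h
          · exact Or.inl (Or.inr ⟨_, h⟩)
          · exact Or.inr ⟨_, h⟩
      · rcases h2 with rfl | h2
        · exact Or.inl (Or.inr ⟨_, hout _ h1⟩)
        · rcases BB_in hc (Or.inr (Or.inl (hout _ h1))) h2 with h | h
          · exact Or.inl (Or.inr ⟨_, h⟩)
          · exact Or.inr ⟨_, h⟩
  rcases key b h with (h | h) | h
  · exact absurd h.symm hab
  · exact h
  · exact h

/-- Open walks. -/
structure OWalk (E : I → I → Prop) (S : Set I) (a b : I) (n : ℕ) (f : ℕ → I) : Prop where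
  first : f 0 = a
  last : f n = b
  adj : ∀ i, i < n → E (f i) (f (i + 1)) ∨ E (f (i + 1)) (f i)
  coll : ∀ i, i + 1 < n → E (f i) (f (i + 1)) → E (f (i + 2)) (f (i + 1)) → f (i + 1) ∈ AncS E S
  non : ∀ i, i + 1 < n → ¬ (E (f i) (f (i + 1)) ∧ E (f (i + 2)) (f (i + 1))) → f (i + 1) ∉ S

theorem OWalk_append {E : I → I → Prop} {S : Set I} {a u v : I} {n : ℕ} {f : ℕ → I}
    (h : OWalk E S a u (n + 1) f) (huv : E u v ∨ E v u)
    (h1 : E (f n) u → E v u → u ∈ AncS E S)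
    (h2 : ¬ (E (f n) u ∧ E v u) → u ∉ S) :
    OWalk E S a v (n + 2) (fun m => if m ≤ n + 1 then f m else v) := by
  have hl := h.last
  subst hl
  refine ⟨by simp [h.first], by simp, ?_, ?_, ?_⟩
  · intro i hi
    rcases Nat.lt_or_ge i (n + 1) with hi' | hi'
    · have e1 : i ≤ n + 1 := by omega
      have e2 : i + 1 ≤ n + 1 := by omega
      simp only [e1, e2, if_true]
      exact h.adj i hi'
    · have : i = n + 1 := by omega
      subst this
      simpa using huv
  · intro i hi
    rcases Nat.lt_or_ge i n with hi' | hi'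
    · have e1 : i ≤ n + 1 := by omega
      have e2 : i + 1 ≤ n + 1 := by omega
      have e3 : i + 2 ≤ n + 1 := by omega
      simp only [e1, e2, e3, if_true]
      exact h.coll i (by omega)
    · have : i = n := by omega
      subst this
      simpa using h1
  · intro i hi
    rcases Nat.lt_or_ge i n with hi' | hi'
    · have e1 : i ≤ n + 1 := by omega
      have e2 : i + 1 ≤ n + 1 := by omega
      have e3 : i + 2 ≤ n + 1 := by omega
      simp only [e1, e2, e3, if_true]
      exact h.non i (by omega)
    · have : i = n := by omega
      subst this
      simpa using h2

theorem OWalk_of_BB {E : I → I → Prop} (hdag : Irreflexive (Relation.TransGen E))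
    {S : Set I} {a u : I} {d : Bool} (h : BB E S a d u) :
    ∃ n f, OWalk E S a u (n + 1) f ∧ (d = true → E (f n) u) ∧ (d = false → E u (f n)) := by
  have asym : ∀ x y, E x y → ¬ E y x := fun x y h1 h2 =>
    hdag x (Relation.TransGen.tail (Relation.TransGen.single h1) h2)
  have start : ∀ v, (E a v ∨ E v a) → OWalk E S a v (0 + 1) (fun m => if m = 0 then a else v) := by
    intro v hv
    refine ⟨by simp, by simp, ?_, ?_, ?_⟩
    · intro i hi
      have : i = 0 := by omega
      subst this
      simpa using hv
    · intro i hi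
      omega
    · intro i hi
      omega
  induction h with
  | startOut hv => exact ⟨0, _, start _ (Or.inl hv), by simp [hv], by simp⟩
  | startIn hv => exact ⟨0, _, start _ (Or.inr hv), by simp, by simp [hv]⟩
  | out _ hu huv ih =>
    obtain ⟨n, f, hf, h1, h2⟩ := ih
    exact ⟨n + 1, _, OWalk_append hf (Or.inl huv) (fun _ h => absurd h (asym _ _ huv))
      (fun _ => hu), by simp [hf.last, huv], by simp⟩
  | chain _ hu huv ih =>
    obtain ⟨n, f, hf, h1, h2⟩ := ih
    exact ⟨n + 1, _, OWalk_append hf (Or.inr huv) (fun h _ => absurd h (asym _ _ (h2 rfl)))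
      (fun _ => hu), by simp, by simp [hf.last, huv]⟩
  | coll _ hu huv ih =>
    obtain ⟨n, f, hf, h1, h2⟩ := ih
    exact ⟨n + 1, _, OWalk_append hf (Or.inr huv) (fun _ _ => hu)
      (fun h => absurd ⟨h1 rfl, huv⟩ h), by simp, by simp [hf.last, huv]⟩

theorem OWalk_cut {E : I → I → Prop} (hdag : Irreflexive (Relation.TransGen E))
    {S : Set I} {a b : I} {n : ℕ} {f : ℕ → I} (h : OWalk E S a b n f) {i t : ℕ}
    (ht : 0 < t) (hj : i + t ≤ n) (heq : f i = f (i + t)) :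
    ∃ g, OWalk E S a b (n - t) g := by
  set g : ℕ → I := fun m => if m ≤ i then f m else f (m + t) with hg
  have g1 : ∀ m, m ≤ i → g m = f m := fun m hm => by simp [hg, hm]
  have g2 : ∀ m, i ≤ m → g m = f (m + t) := by
    intro m hm
    rcases Nat.eq_or_lt_of_le hm with rfl | hm
    · simp [hg, heq]
    · simp [hg, not_le.2 hm]
  refine ⟨g, by rw [g1 0 (by omega), h.first], ?_, ?_, ?_, ?_⟩
  · rw [g2 _ (by omega), Nat.sub_add_cancel (by omega), h.last]
  · intro m hm
    rcases Nat.lt_or_ge m i with hi | hi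
    · rw [g1 m (by omega), g1 (m + 1) (by omega)]
      exact h.adj m (by omega)
    · rw [g2 m (by omega), g2 (m + 1) (by omega), show m + 1 + t = m + t + 1 by omega]
      exact h.adj _ (by omega)
  · intro m hm
    rcases Nat.lt_trichotomy (m + 1) i with hi | hi | hi
    · rw [g1 m (by omega), g1 (m + 1) (by omega), g1 (m + 2) (by omega)]
      exact h.coll m (by omega)
    · rw [g1 m (by omega), g1 (m + 1) (by omega), g2 (m + 2) (by omega)]
      intro h1 h2
      by_contra hcon
      have key : ∀ s, s < t → E (f (i + s)) (f (i + s + 1)) ∧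
          Relation.TransGen E (f i) (f (i + s + 1)) := by
        intro s
        induction s with
        | zero =>
          intro _
          have : E (f i) (f (i + 1)) := by
            rcases h.adj i (by omega) with h' | h'
            · exact h'
            · exfalso
              subst hi
              exact hcon (h.coll m (by omega) h1 h')
          exact ⟨this, Relation.TransGen.single this⟩
        | succ s ih =>
          intro hs
          obtain ⟨h3, h4⟩ := ih (by omega)
          have : E (f (i + s + 1)) (f (i + s + 2)) := by
            rcases h.adj (i + s + 1) (by omega) with h' | h'
            · exact h'
            · exfalso
              obtain ⟨d, hd, hda⟩ := h.coll (i + s) (by omega) h3 h'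
              apply hcon
              rw [hi]
              exact ⟨d, hd, h4.to_reflTransGen.trans hda⟩
          exact ⟨this, h4.tail this⟩
      have := (key (t - 1) (by omega)).2
      rw [show i + (t - 1) + 1 = i + t by omega, ← heq] at this
      exact hdag _ this
    · rw [g2 m (by omega), g2 (m + 1) (by omega), g2 (m + 2) (by omega),
        show m + 1 + t = m + t + 1 by omega, show m + 2 + t = m + t + 2 by omega]
      exact h.coll _ (by omega)
  · intro m hm
    rcases Nat.lt_trichotomy (m + 1) i with hi | hi | hi
    · rw [g1 m (by omega), g1 (m + 1) (by omega), g1 (m + 2) (by omega)]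
      exact h.non m (by omega)
    · rw [g1 m (by omega), g1 (m + 1) (by omega), g2 (m + 2) (by omega)]
      intro h1 hS
      apply h1
      constructor
      · by_contra h2
        exact h.non m (by omega) (fun h => h2 h.1) hS
      · by_contra h2
        rw [hi, heq] at hS
        refine h.non (m + t) (by omega) (fun h => h2 ?_) ?_
        · have := h.2
          rw [show m + t + 2 = m + 2 + t by omega, show m + t + 1 = i + t by omega, ← heq, ← hi] at this
          exact this
        · rwa [show m + t + 1 = i + t by omega]
    · rw [g2 m (by omega), g2 (m + 1) (by omega), g2 (m + 2) (by omega),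
        show m + 1 + t = m + t + 1 by omega, show m + 2 + t = m + t + 2 by omega]
      exact h.non _ (by omega)

theorem path_of_MConn {E : I → I → Prop} (hdag : Irreflexive (Relation.TransGen E))
    {S : Set I} {a b : I} (hab : a ≠ b)
    (h : MConn E (AncS E ({a, b} ∪ S)) S a b) : ∃ p : GPath E a b, p.OpenGiven S := by
  obtain ⟨d, hd⟩ := BB_of_MConn hab h
  obtain ⟨n, f, hf, -⟩ := OWalk_of_BB hdag hd
  have hex : ∃ n f, OWalk E S a b n f := ⟨_, _, hf⟩
  set n := Nat.find hex with hn
  obtain ⟨f, hf⟩ := Nat.find_spec hex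
  have hmin : ∀ i t, 0 < t → i + t ≤ n → f i ≠ f (i + t) := by
    intro i t ht hit heq
    obtain ⟨g, hg⟩ := OWalk_cut hdag hf ht hit heq
    exact Nat.find_min hex (m := n - t) (by omega) ⟨g, hg⟩
  have hpos : 0 < n := by
    rcases Nat.eq_zero_or_pos n with h0 | h0
    · exfalso
      apply hab
      rw [← hf.first, ← hf.last]
      congr 1
      exact h0.symm
    · exact h0
  refine ⟨⟨n, hpos, f, hf.first, hf.last, ?_, hf.adj⟩, ?_, ?_⟩
  · intro i j hi hj hij
    by_contra hne
    rcases Nat.lt_or_gt_of_ne hne with hlt | hlt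
    · exact hmin i (j - i) (by omega) (by omega) (by rw [hij]; congr 1; omega)
    · exact hmin j (i - j) (by omega) (by omega) (by rw [← hij]; congr 1; omega)
  · intro i h0 hi hc
    obtain ⟨m, rfl⟩ : ∃ m, i = m + 1 := ⟨i - 1, by omega⟩
    exact hf.non m hi (fun h => hc ⟨h0, hi, h.1, h.2⟩)
  · rintro i ⟨h0, hi, h1, h2⟩
    obtain ⟨m, rfl⟩ : ∃ m, i = m + 1 := ⟨i - 1, by omega⟩
    exact hf.coll m hi h1 h2


theorem MStep.symm' {E : I → I → Prop} {Fc S : Set I} {u v : I} (h : MStep E Fc S u v) :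
    MStep E Fc S v u := by
  obtain ⟨h1, h2, c, hc, h3, h4⟩ := h
  exact ⟨h2, h1, c, hc, h4, h3⟩

theorem MConn.symm' {E : I → I → Prop} {Fc S : Set I} {u v : I} (h : MConn E Fc S u v) :
    MConn E Fc S v u := by
  induction h with
  | refl => exact Relation.ReflTransGen.refl
  | tail h1 h2 ih => exact Relation.ReflTransGen.head h2.symm' ih

theorem MConn.mono' {E : I → I → Prop} {Fc Fc' S S' : Set I} {u v : I} (h : MConn E Fc S u v)
    (hF : Fc ⊆ Fc') (hS : S' ⊆ S) : MConn E Fc' S' u v := by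
  induction h with
  | refl => exact Relation.ReflTransGen.refl
  | tail h1 h2 ih =>
    obtain ⟨h3, h4, c, hc, h5⟩ := h2
    exact ih.tail ⟨fun h => h3 (hS h), fun h => h4 (hS h), c, hF hc, h5⟩

theorem AncS_mono {E : I → I → Prop} {S S' : Set I} (h : S ⊆ S') : AncS E S ⊆ AncS E S' := by
  rintro a ⟨s, hs, ha⟩
  exact ⟨s, h hs, ha⟩

theorem AncS_sub {E : I → I → Prop} {S S' : Set I} (h : S ⊆ AncS E S') :
    AncS E S ⊆ AncS E S' := by
  rintro a ⟨s, hs, ha⟩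
  obtain ⟨t, ht, hst⟩ := h hs
  exact ⟨t, ht, ha.trans hst⟩

theorem step1 {E : I → I → Prop} (hdag : Irreflexive (Relation.TransGen E))
    {T : Set I} {x y w : I}
    (hw : MConn E (AncS E ({w, y} ∪ T)) T w y)
    (hn : ¬ MConn E (AncS E ({w, y} ∪ (T ∪ {x}))) (T ∪ {x}) w y)
    (hxw : ¬ Anc E x w) (hxT : ∀ t ∈ T, ¬ Anc E x t) (hwT : w ∉ T) (hyx : y ≠ x) (hyT : y ∉ T) :
    Anc E x y ∧ AdjSep E {x} y T := by
  set A := AncS E ({w, y} ∪ T) with hA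
  set A' := AncS E ({w, y} ∪ (T ∪ {x})) with hA'
  have hAA : A ⊆ A' := AncS_mono (by intro i; simp; tauto)
  have hwx : w ≠ x := by
    rintro rfl
    exact hxw Relation.ReflTransGen.refl
  have hwS : w ∉ T ∪ {x} := by simp [hwT, hwx]
  have key : ∀ u, MConn E A T w u → MConn E A' (T ∪ {x}) w u ∨
      ∃ u0, MConn E A' (T ∪ {x}) w u0 ∧ MStep E A T u0 x := by
    intro u hu
    induction hu with
    | refl => exact Or.inl Relation.ReflTransGen.refl
    | tail hpre hst ih =>
      rename_i u v
      rcases ih with ih | ih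
      swap
      · exact Or.inr ih
      by_cases hv : v = x
      · subst hv
        exact Or.inr ⟨u, ih, hst⟩
      · left
        have hu := MConn_notMem hwS ih
        obtain ⟨h3, h4, c, hc, h5⟩ := hst
        exact ih.tail ⟨hu, by simp [h4, hv], c, hAA hc, h5⟩
  obtain ⟨u0, hu0, hst⟩ := (key y hw).resolve_left hn
  have hu0S := MConn_notMem hwS hu0
  obtain ⟨-, -, c, hc, h1, h2⟩ := hst
  have hxc : Anc E x c := by
    rcases h2 with rfl | h2
    · exact Relation.ReflTransGen.refl
    · exact Relation.ReflTransGen.single h2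
  have hcy : Anc E c y := by
    obtain ⟨s, hs, hcs⟩ := hc
    rcases hs with (rfl | rfl) | hs
    · exact absurd (hxc.trans hcs) hxw
    · exact hcs
    · exact absurd (hxc.trans hcs) (hxT s hs)
  refine ⟨hxc.trans hcy, ?_⟩
  rintro x' hx' P hP hconn
  have hx'' : x' = x := hx'
  subst hx''
  have hyP : MConn E A' (T ∪ {x'}) y P := hconn.mono' (by
    refine Set.sdiff_subset.trans (AncS_mono ?_)
    intro i
    simp
    tauto) (by rw [Set.union_comm])
  have hyS : y ∉ T ∪ {x'} := by simp [hyT, hyx]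
  rcases h2 with rfl | h2
  · have hE : E u0 x' := by
      rcases h1 with h1 | h1
      · exact absurd (by simp [h1]) hu0S
      · exact h1
    have hm : MStep E A' (T ∪ {x'}) u0 P :=
      ⟨hu0S, MConn_notMem hyS hyP, x', hAA hc, Or.inr hE, Or.inr hP⟩
    exact hn ((hu0.tail hm).trans hyP.symm')
  · have hS : ∀ d, Anc E c d → d ∉ T ∪ {x'} := by
      rintro d hd (hdT | hdx)
      · exact hxT d hdT (hxc.trans hd)
      · have : d = x' := hdx
        subst this
        exact hdag d (Relation.TransGen.head' h2 hd)
    have hm : MStep E A' (T ∪ {x'}) u0 c :=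
      ⟨hu0S, hS c Relation.ReflTransGen.refl, c, hAA hc, h1, Or.inl rfl⟩
    have hdir : ∀ d, Anc E c d → Anc E d y → MConn E A' (T ∪ {x'}) c d := by
      intro d hd
      induction hd with
      | refl => intro _; exact Relation.ReflTransGen.refl
      | tail hcu huv ih =>
        rename_i u v
        intro hvy
        refine (ih (Relation.ReflTransGen.head huv hvy)).tail
          ⟨hS _ hcu, hS _ (hcu.tail huv), v, ?_, Or.inr huv, Or.inl rfl⟩
        exact ⟨y, by simp, hvy⟩
    exact hn ((hu0.tail hm).trans (hdir y hcy Relation.ReflTransGen.refl))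

theorem step1_prob {E : I → I → Prop} (hdag : Irreflexive (Relation.TransGen E))
    {p : (∀ i, α i) → ℝ} (hpos : ∀ v, 0 < p v) (hmarkov : MarkovCompat p E) (hf : Faithful p E)
    {T : Set I} {x y w : I} (hdep : ¬ CondIndep p {w} {y} T)
    (hindep : CondIndep p {w} {y} (T ∪ {x}))
    (hxw : ¬ Anc E x w) (hxT : ∀ t ∈ T, ¬ Anc E x t) (hwT : w ∉ T) (hyx : y ≠ x) (hyT : y ∉ T)
    (hwy : w ≠ y) :
    Anc E x y ∧ AdjSep E {x} y T := by
  have hwx : w ≠ x := by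
    rintro rfl
    exact hxw Relation.ReflTransGen.refl
  refine step1 hdag (w := w) ?_ ?_ hxw hxT hwT hyx hyT
  · by_contra h
    exact hdep (global_markov hdag hpos hmarkov hwT hyT h)
  · intro h
    obtain ⟨q, hq⟩ := path_of_MConn hdag hwy h
    refine (hf {w} {y} (T ∪ {x}) (by simpa using hwy) ?_).1 hindep w rfl y rfl q hq
    rw [Set.disjoint_left]
    rintro i (hi | rfl) (rfl | rfl)
    · exact hwT hi
    · exact hyT hi
    · exact hwx rfl
    · exact hyx rfl

theorem AdjSep_of_condIndep {E : I → I → Prop} (hdag : Irreflexive (Relation.TransGen E))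
    {p : (∀ i, α i) → ℝ} (hf : Faithful p E) {Z : Set I} {x y : I}
    (hyx : ¬ Anc E y x) (hyZ : y ∉ Z)
    (h : CondIndep p {y} ({j | E j x} \ Z) ({x} ∪ Z)) : AdjSep E {x} y Z := by
  have hyx' : y ≠ x := by
    rintro rfl
    exact hyx Relation.ReflTransGen.refl
  have hyP : ¬ E y x := fun h => hyx (Relation.ReflTransGen.single h)
  rintro x' hx' P hP hconn
  have hx'' : x' = x := hx'
  subst hx''
  have hPS := MConn_notMem (by simp [hyx', hyZ]) hconn
  have hPy : y ≠ P := by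
    rintro rfl
    exact hyP hP
  obtain ⟨q, hq⟩ := path_of_MConn hdag hPy (hconn.mono' (by
    refine Set.sdiff_subset.trans (AncS_mono ?_)
    intro i
    simp
    tauto) subset_rfl)
  refine (hf _ _ _ ?_ ?_).1 h y rfl P ⟨hP, fun h => hPS (Or.inr h)⟩ q hq
  · rw [Set.disjoint_left]
    rintro i rfl ⟨h1, h2⟩
    exact hyP h1
  · rw [Set.disjoint_left]
    rintro i (rfl | hi) (rfl | ⟨h1, h2⟩)
    · exact hyx' rfl
    · exact acyc_ne hdag h1 rfl
    · exact hyZ hi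
    · exact h2 hi

theorem AdjSep_inter {E : I → I → Prop} {Z : Set I} {x y : I}
    (h : AdjSep E {x} y Z) : AdjSep E {x} y (Z ∩ AncS E {x, y}) := by
  intro x' hx' P hP hconn
  have hx'' : x' = x := hx'
  subst hx''
  apply h x' rfl P hP
  have hsub : AncS E ({x'} ∪ Z ∩ AncS E {x', y} ∪ {y}) ⊆ AncS E {x', y} := by
    apply AncS_sub
    rintro i ((rfl | hi) | rfl)
    · exact sub_AncS (by simp)
    · exact hi.2
    · exact sub_AncS (by simp)
  have key : ∀ u, MConn E (AncS E ({x'} ∪ Z ∩ AncS E {x', y} ∪ {y}) \ {x'})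
      ({x'} ∪ Z ∩ AncS E {x', y}) y u →
      MConn E (AncS E ({x'} ∪ Z ∪ {y}) \ {x'}) ({x'} ∪ Z) y u := by
    intro u hu
    induction hu with
    | refl => exact Relation.ReflTransGen.refl
    | tail hpre hst ih =>
      obtain ⟨h3, h4, c, hc, h5, h6⟩ := hst
      have hn : ∀ u, u ∉ {x'} ∪ Z ∩ AncS E {x', y} → (u = c ∨ E u c) → u ∉ {x'} ∪ Z := by
        rintro u hu huc (h | h)
        · exact hu (Or.inl h)
        · refine hu (Or.inr ⟨h, ?_⟩)
          rcases huc with rfl | huc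
          · exact hsub hc.1
          · exact AncS_closed huc (hsub hc.1)
      refine ih.tail ⟨hn _ h3 h5, hn _ h4 h6, c, ⟨?_, hc.2⟩, h5, h6⟩
      exact AncS_mono (by intro i; simp; tauto) (hsub hc.1)
  exact key P hconn

theorem AdjSep_joint {E : I → I → Prop} {k : ℕ} {X : Fin (k + 1) → I} {Y : I}
    {Zf : Fin (k + 1) → Set I} (hsep : ∀ i, AdjSep E {X i} Y (Zf i))
    (hXY : ∀ i, Anc E (X i) Y) (hZ : ∀ i, Zf i ⊆ AncS E {Y}) :
    AdjSep E (Set.range X) Y ((⋃ i, Zf i) \ Set.range X) := by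
  rintro _ ⟨i, rfl⟩ P hP hconn
  refine hsep i (X i) rfl P hP (hconn.mono' ?_ ?_)
  · rintro c ⟨hc, hcX⟩
    have h1 : c ∈ AncS E {Y} := by
      refine AncS_sub ?_ hc
      rintro j ((⟨m, rfl⟩ | ⟨hj, -⟩) | rfl)
      · exact ⟨Y, rfl, hXY m⟩
      · obtain ⟨m, hm⟩ := Set.mem_iUnion.1 hj
        exact hZ m hm
      · exact sub_AncS rfl
    refine ⟨AncS_mono (by intro j; simp; tauto) h1, ?_⟩
    rintro rfl
    exact hcX ⟨i, rfl⟩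
  · rintro j (rfl | hj)
    · exact Or.inl ⟨i, rfl⟩
    · by_cases hjX : j ∈ Set.range X
      · exact Or.inl hjX
      · exact Or.inr ⟨Set.mem_iUnion.2 ⟨i, hj⟩, hjX⟩


theorem Mg_update {Z : Set I} {i : I} (hi : i ∈ Z) (F : (∀ i, α i) → ℝ) (c : α i)
    (w : ∀ i, α i) :
    Mg Zᶜ (fun u => F (Function.update u i c)) w = Mg Zᶜ F (Function.update w i c) := by
  rw [Mg_eq_filter, Mg_eq_filter]
  refine Finset.sum_bij' (fun u _ => Function.update u i c)
    (fun u _ => Function.update u i (w i)) ?_ ?_ ?_ ?_ ?_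
  · intro u hu
    simp only [Finset.mem_filter, Finset.mem_univ, true_and] at hu ⊢
    intro j hj
    by_cases h : j = i
    · subst h; simp
    · simp only [Function.update_of_ne h]
      exact hu j hj
  · intro u hu
    simp only [Finset.mem_filter, Finset.mem_univ, true_and] at hu ⊢
    intro j hj
    by_cases h : j = i
    · subst h; simp
    · simp only [Function.update_of_ne h]
      have := hu j hj
      rwa [Function.update_of_ne h] at this
  · intro u hu
    simp only [Finset.mem_filter, Finset.mem_univ, true_and] at hu
    have h1 := hu i (by simp [hi])
    simp [← h1]
  · intro u hu
    simp only [Finset.mem_filter, Finset.mem_univ, true_and] at hu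
    have h1 := hu i (by simp [hi])
    simp only [Function.update_self] at h1
    simp [← h1]
  · intro u hu
    rfl

/-- Unnormalized conditional expectation of `e` given the `Z`-coordinates of `w`. -/
noncomputable def Ex (Z : Set I) (k : I → (∀ i, α i) → ℝ) (e : (∀ i, α i) → ℝ) (w : ∀ i, α i) : ℝ :=
  Mg Zᶜ (fun u => e u * PK k Set.univ u) w

def PSep (E : I → I → Prop) (A Z : Set I) (w w' : ∀ i, α i) : Prop :=
  ∃ (k : I → (∀ i, α i) → ℝ) (e : (∀ i, α i) → ℝ), IsKer E k ∧ DepOn e A ∧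
    Ex Z k e w * Ex Z k (fun _ => 1) w' ≠ Ex Z k e w' * Ex Z k (fun _ => 1) w

theorem PK_univ_split (k : I → (∀ i, α i) → ℝ) (i : I) (u : ∀ i, α i) :
    PK k Set.univ u = k i u * PK k {i}ᶜ u := by
  rw [← PK_singleton (k := k) i u, ← PK_union disjoint_compl_right, Set.union_compl_self]

theorem IsKer.le_one {E : I → I → Prop} {k : I → (∀ i, α i) → ℝ} (hk : IsKer E k) (i : I)
    (u : ∀ i, α i) : k i u ≤ 1 := by
  rw [← hk.sum i u, Mg_singleton]
  have := Finset.single_le_sum (f := fun a => k i (Function.update u i a))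
    (fun a _ => (hk.pos i _).le) (Finset.mem_univ (u i))
  simpa using this

theorem dep_comp_update {F : (∀ i, α i) → ℝ} {S : Set I} (h : DepOn F S) (i : I)
    (σ : α i → α i) : DepOn (fun u => F (Function.update u i (σ (u i)))) S := by
  intro u u' huu
  apply h
  intro j hj
  by_cases hji : j = i
  · subst hji
    simp [huu j hj]
  · simp [Function.update_of_ne hji, huu j hj]

theorem sum_comp_update {E : I → I → Prop} {k : I → (∀ i, α i) → ℝ} (hk : IsKer E k) {i m : I}
    (hm : m ≠ i) (σ : α i → α i) (u : ∀ i, α i) :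
    Mg {m} (fun u => k m (Function.update u i (σ (u i)))) u = 1 := by
  rw [← hk.sum m (Function.update u i (σ (u i))), Mg_singleton, Mg_singleton]
  refine Finset.sum_congr rfl fun a _ => ?_
  rw [Function.update_of_ne hm.symm, Function.update_comm hm]

theorem PSep_perm {E : I → I → Prop} {A Z : Set I} {v v' : ∀ i, α i} (h : PSep E A Z v v')
    {i : I} (hi : i ∈ Z) (σ : Equiv.Perm (α i)) {c c' : α i} (hc : σ c = v i) (hc' : σ c' = v' i) :
    PSep E A Z (Function.update v i c) (Function.update v' i c') := by
  obtain ⟨k, e, hk, he, hne⟩ := h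
  set k' : I → (∀ i, α i) → ℝ := fun m u => k m (Function.update u i (σ (u i))) with hk'
  have hker : IsKer E k' := by
    refine ⟨fun m u => hk.pos _ _, fun m => dep_comp_update (hk.dep m) i σ, fun m u => ?_⟩
    by_cases hm : m = i
    · subst hm
      rw [← hk.sum m u, Mg_singleton, Mg_singleton]
      simp only [hk', Function.update_self, Function.update_idem]
      exact Equiv.sum_comp σ (fun a => k m (Function.update u m a))
    · exact sum_comp_update hk hm σ u
  have key : ∀ g : (∀ i, α i) → ℝ, ∀ v : ∀ i, α i, ∀ c : α i, σ c = v i →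
      Ex Z k' (fun u => g (Function.update u i (σ (u i)))) (Function.update v i c) = Ex Z k g v := by
    intro g v c hc
    unfold Ex
    have h1 : ∀ u, (∀ j, j ∉ Zᶜ → u j = Function.update v i c j) →
        g (Function.update u i (σ (u i))) * PK k' Set.univ u =
        (fun u => (fun u => g u * PK k Set.univ u) (Function.update u i (v i))) u := by
      intro u hu
      have h2 := hu i (by simp [hi])
      simp only [Function.update_self] at h2
      have h3 : PK k' Set.univ u = PK k Set.univ (Function.update u i (σ (u i))) := rfl
      rw [h3, h2, hc]
    rw [Mg_congr h1, Mg_update hi (fun u => g u * PK k Set.univ u)]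
    simp
  refine ⟨k', _, hker, dep_comp_update he i σ, ?_⟩
  rw [key e v c hc, key e v' c' hc', key (fun _ => 1) v c hc, key (fun _ => 1) v' c' hc']
  exact hne

theorem PSep_split {E : I → I → Prop} {A Z : Set I} {v v' : ∀ i, α i} (h : PSep E A Z v v')
    {i : I} (hi : i ∈ Z) (hvv : v i = v' i) {c c' : α i} (hcc : c ≠ c') :
    PSep E A Z (Function.update v i c) (Function.update v' i c') := by
  obtain ⟨k, e, hk, he, hne⟩ := h
  set c0 := v i with hc0
  set n : ℝ := (Fintype.card (α i) : ℝ) - 1 with hn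
  have hn0 : 0 < n := by
    have : 1 < Fintype.card (α i) := Fintype.one_lt_card_iff.2 ⟨c, c', hcc⟩
    have : (1 : ℝ) < Fintype.card (α i) := by exact_mod_cast this
    rw [hn]; linarith
  set kk : ℝ → I → (∀ i, α i) → ℝ := fun r m u =>
    if m = i then (if u i = c then r * k i (Function.update u i c0)
      else (1 - r * k i (Function.update u i c0)) / n) else k m (Function.update u i c0) with hkk
  have hker : ∀ r : ℝ, 0 < r → r < 1 → IsKer E (kk r) := by
    intro r hr0 hr1
    refine ⟨fun m u => ?_, fun m => ?_, fun m u => ?_⟩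
    · simp only [hkk]
      have h1 := hk.pos i (Function.update u i c0)
      have h2 := hk.le_one i (Function.update u i c0)
      split_ifs
      · positivity
      · apply div_pos _ hn0
        nlinarith
      · exact hk.pos _ _
    · have h0 := dep_comp_update (hk.dep m) i (fun _ => c0)
      intro u u' huu
      have h1 : k m (Function.update u i c0) = k m (Function.update u' i c0) := h0 u u' huu
      simp only [hkk]
      by_cases hm : m = i
      · subst hm
        rw [if_pos rfl, if_pos rfl, huu m (by simp), h1]
      · rw [if_neg hm, if_neg hm, h1]
    · by_cases hm : m = i
      · subst hm
        rw [Mg_singleton]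
        simp only [hkk, if_true, Function.update_self, Function.update_idem]
        rw [← Finset.add_sum_erase _ _ (Finset.mem_univ c), if_pos rfl,
          Finset.sum_congr rfl (g := fun _ => (1 - r * k m (Function.update u m c0)) / n) (by
            intro a ha
            rw [if_neg (Finset.ne_of_mem_erase ha)]), Finset.sum_const,
          Finset.card_erase_of_mem (Finset.mem_univ _), nsmul_eq_mul, Finset.card_univ,
          Nat.cast_sub Fintype.card_pos, Nat.cast_one, ← hn]
        field_simp
        ring
      · have := sum_comp_update hk hm (fun _ => c0) u
        rw [← this]
        apply Mg_congr
        intro u _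
        simp only [hkk, if_neg hm]
  have hrest : ∀ r u, PK (kk r) {i}ᶜ u = PK k {i}ᶜ (Function.update u i c0) := by
    intro r u
    unfold PK
    refine Finset.prod_congr rfl fun m _ => ?_
    by_cases hm : m ∈ ({i}ᶜ : Set I)
    · rw [if_pos hm, if_pos hm]
      have : m ≠ i := hm
      simp only [hkk, if_neg this]
    · rw [if_neg hm, if_neg hm]
  have key1 : ∀ r : ℝ, ∀ g : (∀ i, α i) → ℝ,
      Ex Z (kk r) (fun u => g (Function.update u i c0)) (Function.update v i c) =
        r * Ex Z k g v := by
    intro r g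
    unfold Ex
    have h1 : ∀ u, (∀ j, j ∉ Zᶜ → u j = Function.update v i c j) →
        g (Function.update u i c0) * PK (kk r) Set.univ u =
        (fun u => r * (fun u => (fun u => g u * PK k Set.univ u) (Function.update u i c0)) u) u := by
      intro u hu
      have h2 := hu i (by simp [hi])
      simp only [Function.update_self] at h2
      rw [PK_univ_split _ i, hrest]
      simp only [hkk, if_true, h2]
      rw [PK_univ_split k i]
      ring
    rw [Mg_congr h1, Mg_const_mul, Mg_update hi (fun u => g u * PK k Set.univ u)]
    simp [hc0]
  have key2 : ∀ r : ℝ, ∀ g : (∀ i, α i) → ℝ,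
      Ex Z (kk r) (fun u => g (Function.update u i c0)) (Function.update v' i c') =
        n⁻¹ * (Mg Zᶜ (fun u => g u * PK k {i}ᶜ u) v' + (-r) * Ex Z k g v') := by
    intro r g
    unfold Ex
    have h1 : ∀ u, (∀ j, j ∉ Zᶜ → u j = Function.update v' i c' j) →
        g (Function.update u i c0) * PK (kk r) Set.univ u =
        (fun u => (fun u => n⁻¹ * (fun u => g u * PK k {i}ᶜ u + (-r) * (g u * PK k Set.univ u)) u)
          (Function.update u i c0)) u := by
      intro u hu
      have h2 := hu i (by simp [hi])
      simp only [Function.update_self] at h2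
      rw [PK_univ_split _ i, hrest]
      simp only [hkk, if_true, h2, if_neg hcc.symm]
      rw [PK_univ_split k i]
      field_simp
      ring
    rw [Mg_congr h1, Mg_update hi (fun u => n⁻¹ * (fun u => g u * PK k {i}ᶜ u + (-r) * (g u * PK k Set.univ u)) u),
      Mg_const_mul, Mg_add, Mg_const_mul]
    have : Function.update (Function.update v' i c') i c0 = v' := by
      rw [hvv]; simp
    rw [this]
  have hdep : DepOn (fun u => e (Function.update u i c0)) A := dep_comp_update he i (fun _ => c0)
  by_contra hcon
  have hall : ∀ r : ℝ, 0 < r → r < 1 →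
      Ex Z k e v * (Mg Zᶜ (fun u => 1 * PK k {i}ᶜ u) v' + (-r) * Ex Z k (fun _ => 1) v') =
      (Mg Zᶜ (fun u => e u * PK k {i}ᶜ u) v' + (-r) * Ex Z k e v') * Ex Z k (fun _ => 1) v := by
    intro r hr0 hr1
    by_contra hr
    apply hcon
    refine ⟨kk r, _, hker r hr0 hr1, hdep, ?_⟩
    have k1 := key1 r (fun _ => 1)
    have k2 := key2 r (fun _ => 1)
    rw [key1, key2, k1, k2]
    intro h
    apply hr
    have hni : n⁻¹ * r ≠ 0 := by positivity
    apply mul_left_cancel₀ hni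
    linear_combination h
  have e1 := hall (1/2) (by norm_num) (by norm_num)
  have e2 := hall (1/3) (by norm_num) (by norm_num)
  apply hne
  linear_combination 6 * e2 - 6 * e1

theorem exists_perm2 {β : Type*} {a b a' b' : β} (h : a ≠ b) (h' : a' ≠ b') :
    ∃ σ : Equiv.Perm β, σ a = a' ∧ σ b = b' := by
  refine ⟨(Equiv.swap a a').trans (Equiv.swap (Equiv.swap a a' b) b'), ?_, ?_⟩
  · simp only [Equiv.trans_apply, Equiv.swap_apply_left]
    apply Equiv.swap_apply_of_ne_of_ne
    · intro hh
      apply h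
      apply (Equiv.swap a a').injective
      rw [← hh]; simp
    · exact h'
  · simp

theorem Ex_dep (Z : Set I) (k : I → (∀ i, α i) → ℝ) (e : (∀ i, α i) → ℝ) : DepOn (Ex Z k e) Z := by
  have h : DepOn (fun u => e u * PK k Set.univ u) Set.univ := by
    intro u u' h
    have : u = u' := funext fun i => h i trivial
    rw [this]
  refine (DepOn_Mg (D := Zᶜ) h).mono ?_
  intro i hi
  simpa using hi.2

/-- Separation of pairs. -/
theorem PSep_all {E : I → I → Prop} {A Z : Set I} {v : ∀ i, α i} {j : I} (hj : j ∈ Z) {b : α j}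
    (h : PSep E A Z v (Function.update v j b)) {w w' : ∀ i, α i} (hw : w j ≠ w' j) :
    PSep E A Z w w' := by
  have hb : v j ≠ b := by
    rintro rfl
    obtain ⟨k, e, _, _, hne⟩ := h
    apply hne
    simp
  have key : ∀ s : Finset I, j ∉ s → PSep E A Z (s.piecewise w v)
      (s.piecewise w' (Function.update v j b)) := by
    intro s
    induction s using Finset.induction_on with
    | empty => intro _; simpa using h
    | insert i s his ih =>
      intro hjs
      have hji : i ≠ j := by rintro rfl; simp at hjs
      have ih' := ih (fun h => hjs (Finset.mem_insert_of_mem h))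
      rw [Finset.piecewise_insert, Finset.piecewise_insert]
      by_cases hi : i ∈ Z
      · have e1 : s.piecewise w v i = v i := by simp [his]
        have e2 : s.piecewise w' (Function.update v j b) i = v i := by simp [his, hji]
        by_cases hww : w i = w' i
        · exact PSep_perm ih' hi (Equiv.swap (w i) (v i)) (by simp [his]) (by rw [← hww]; simp [his, hji])
        · exact PSep_split ih' hi (by rw [e1, e2]) hww
      · obtain ⟨k, e, hk, he, hne⟩ := ih'
        refine ⟨k, e, hk, he, ?_⟩
        have hu : ∀ g, ∀ u : ∀ i, α i, ∀ c, Ex Z k g (Function.update u i c) = Ex Z k g u := by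
          intro g u c
          apply Ex_dep
          intro m hm
          rw [Function.update_of_ne]
          rintro rfl
          exact hi hm
        simp only [hu]
        exact hne
  have h1 := key (Finset.univ.erase j) (by simp)
  obtain ⟨σ, hσ, hσ'⟩ := exists_perm2 hw hb
  have h2 := PSep_perm h1 hj σ (c := w j) (c' := w' j) (by simp [hσ]) (by simp [hσ'])
  convert h2 using 1
  · funext i
    by_cases hi : i = j
    · subst hi; simp
    · simp [Function.update_of_ne hi, hi, Finset.piecewise]
  · funext i
    by_cases hi : i = j
    · subst hi; simp
    · simp [Function.update_of_ne hi, hi, Finset.piecewise]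


/-- Partial fractions. -/
theorem pf_lemma {ι : Type*} (s : Finset ι) (a l : ι → ℝ) (s0 : ℝ)
    (h : ∀ t, s0 ≤ t → ∑ i ∈ s, a i / (t + l i) = 0) (Q : ι → Prop)
    (hQ : ∀ i ∈ s, ∀ j ∈ s, Q i → ¬ Q j → l i ≠ l j) :
    ∑ i ∈ s with Q i, a i = 0 := by
  set L := s.image l with hL
  set P : Polynomial ℝ := ∑ i ∈ s, Polynomial.C (a i) *
    ∏ c ∈ L.erase (l i), (Polynomial.X + Polynomial.C c) with hP
  have hev : ∀ t, P.eval t = ∑ i ∈ s, a i * ∏ c ∈ L.erase (l i), (t + c) := by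
    intro t
    simp [hP, Polynomial.eval_finset_sum, Polynomial.eval_prod]
  obtain ⟨s1, hs1⟩ : ∃ s1 : ℝ, ∀ t, s1 ≤ t → ∀ c ∈ L, 0 < t + c := by
    refine ⟨∑ c ∈ L, |c| + 1, fun t ht c hc => ?_⟩
    have h1 : |c| ≤ ∑ c ∈ L, |c| := Finset.single_le_sum (f := fun c : ℝ => |c|)
      (fun _ _ => abs_nonneg _) hc
    have h2 := neg_abs_le c
    linarith
  have hroot : ∀ t, max s0 s1 ≤ t → P.eval t = 0 := by
    intro t ht
    have h1 := h t (le_trans (le_max_left _ _) ht)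
    have h2 := hs1 t (le_trans (le_max_right _ _) ht)
    rw [hev]
    have : ∑ i ∈ s, a i * ∏ c ∈ L.erase (l i), (t + c) =
        (∏ c ∈ L, (t + c)) * ∑ i ∈ s, a i / (t + l i) := by
      rw [Finset.mul_sum]
      refine Finset.sum_congr rfl fun i hi => ?_
      have hm : l i ∈ L := Finset.mem_image_of_mem _ hi
      rw [← Finset.mul_prod_erase _ _ hm]
      have := (h2 _ hm).ne'
      field_simp
    rw [this, h1, mul_zero]
  have hP0 : P = 0 := by
    apply Polynomial.eq_zero_of_infinite_isRoot
    apply Set.Infinite.mono (s := Set.Ici (max s0 s1))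
    · intro t ht
      exact hroot t ht
    · exact Set.Ici_infinite _
  have hcls : ∀ d ∈ L, ∑ i ∈ s with l i = d, a i = 0 := by
    intro d hd
    have h1 : P.eval (-d) = 0 := by rw [hP0]; simp
    rw [hev] at h1
    have h2 : ∑ i ∈ s, a i * ∏ c ∈ L.erase (l i), (-d + c) =
        (∑ i ∈ s with l i = d, a i) * ∏ c ∈ L.erase d, (-d + c) := by
      rw [Finset.sum_mul, Finset.sum_filter]
      refine Finset.sum_congr rfl fun i hi => ?_
      by_cases hid : l i = d
      · rw [if_pos hid, hid]
      · rw [if_neg hid, Finset.prod_eq_zero (i := d), mul_zero]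
        · exact Finset.mem_erase.2 ⟨fun h => hid h.symm, hd⟩
        · ring
    rw [h2] at h1
    refine (mul_eq_zero.1 h1).resolve_right ?_
    refine Finset.prod_ne_zero_iff.2 ?_
    intro c hc h0
    apply Finset.ne_of_mem_erase hc
    linarith
  rw [← Finset.sum_fiberwise_of_maps_to (s := s.filter Q) (t := (s.filter Q).image l) (g := l)
    (fun i hi => Finset.mem_image_of_mem _ hi)]
  apply Finset.sum_eq_zero
  intro d hd
  obtain ⟨i, hi, rfl⟩ := Finset.mem_image.1 hd
  rw [Finset.mem_filter] at hi
  rw [← hcls (l i) (Finset.mem_image_of_mem _ hi.1)]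
  apply Finset.sum_congr _ (fun _ _ => rfl)
  ext j
  simp only [Finset.mem_filter]
  constructor
  · rintro ⟨⟨h1, _⟩, h2⟩
    exact ⟨h1, h2⟩
  · rintro ⟨h1, h2⟩
    refine ⟨⟨h1, ?_⟩, h2⟩
    by_contra hj
    exact hQ i hi.1 j h1 hi.2 hj h2.symm

/-- Functions that are polynomial along lines. -/
def PolyL {M : Type*} [AddCommGroup M] [Module ℝ M] (f : M → ℝ) : Prop :=
  ∀ a b : M, ∃ P : Polynomial ℝ, ∀ t : ℝ, f (a + t • (b - a)) = P.eval t

section PolyLsec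

variable {M : Type*} [AddCommGroup M] [Module ℝ M]

theorem PolyL.const (c : ℝ) : PolyL (fun _ : M => c) :=
  fun _ _ => ⟨Polynomial.C c, fun t => by simp⟩

theorem PolyL.lin (f : M →ₗ[ℝ] ℝ) : PolyL (fun m : M => f m) := fun a b =>
  ⟨Polynomial.C (f a) + Polynomial.X * Polynomial.C (f b - f a), fun t => by simp⟩

theorem PolyL.add {f g : M → ℝ} (hf : PolyL f) (hg : PolyL g) : PolyL (fun m => f m + g m) := by
  intro a b
  obtain ⟨P, hP⟩ := hf a b
  obtain ⟨Q, hQ⟩ := hg a b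
  exact ⟨P + Q, fun t => by simp [hP, hQ]⟩

theorem PolyL.sub {f g : M → ℝ} (hf : PolyL f) (hg : PolyL g) : PolyL (fun m => f m - g m) := by
  intro a b
  obtain ⟨P, hP⟩ := hf a b
  obtain ⟨Q, hQ⟩ := hg a b
  exact ⟨P - Q, fun t => by simp [hP, hQ]⟩

theorem PolyL.mul {f g : M → ℝ} (hf : PolyL f) (hg : PolyL g) : PolyL (fun m => f m * g m) := by
  intro a b
  obtain ⟨P, hP⟩ := hf a b
  obtain ⟨Q, hQ⟩ := hg a b
  exact ⟨P * Q, fun t => by simp [hP, hQ]⟩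

theorem PolyL.sum {ι : Type*} {s : Finset ι} {f : ι → M → ℝ} (hf : ∀ i ∈ s, PolyL (f i)) :
    PolyL (fun m => ∑ i ∈ s, f i m) := by
  induction s using Finset.induction_on with
  | empty => simpa using PolyL.const 0
  | insert i s his ih =>
    simp only [Finset.sum_insert his]
    exact (hf i (Finset.mem_insert_self _ _)).add
      (ih fun j hj => hf j (Finset.mem_insert_of_mem hj))

theorem PolyL.prod {ι : Type*} {s : Finset ι} {f : ι → M → ℝ} (hf : ∀ i ∈ s, PolyL (f i)) :
    PolyL (fun m => ∏ i ∈ s, f i m) := by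
  induction s using Finset.induction_on with
  | empty => simpa using PolyL.const 1
  | insert i s his ih =>
    simp only [Finset.prod_insert his]
    exact (hf i (Finset.mem_insert_self _ _)).mul
      (ih fun j hj => hf j (Finset.mem_insert_of_mem hj))

theorem PolyL.cancel {Θ : Set M}
    (hΘ : ∀ a ∈ Θ, ∀ b ∈ Θ, ∀ t : ℝ, 0 ≤ t → t ≤ 1 → a + t • (b - a) ∈ Θ)
    {f g : M → ℝ} (hf : PolyL f) (hg : PolyL g) (h : ∀ m ∈ Θ, f m * g m = 0)
    (hb : ∃ b ∈ Θ, g b ≠ 0) : ∀ a ∈ Θ, f a = 0 := by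
  intro a ha
  obtain ⟨b, hb, hgb⟩ := hb
  obtain ⟨P, hP⟩ := hf a b
  obtain ⟨Q, hQ⟩ := hg a b
  have h0 : P * Q = 0 := by
    apply Polynomial.eq_zero_of_infinite_isRoot
    apply Set.Infinite.mono (s := Set.Icc (0 : ℝ) 1)
    · intro t ht
      have := h _ (hΘ a ha b hb t ht.1 ht.2)
      rw [hP, hQ] at this
      simpa [Polynomial.IsRoot] using this
    · exact Set.Icc_infinite one_pos
  have hQ0 : Q ≠ 0 := by
    rintro rfl
    have := hQ 1
    simp at this
    exact hgb this
  have hP0 : P = 0 := (mul_eq_zero.1 h0).resolve_right hQ0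
  have := hP 0
  simpa [hP0] using this

theorem PolyL.cancel_prod {Θ : Set M}
    (hΘ : ∀ a ∈ Θ, ∀ b ∈ Θ, ∀ t : ℝ, 0 ≤ t → t ≤ 1 → a + t • (b - a) ∈ Θ)
    {ι : Type*} {s : Finset ι} {g : ι → M → ℝ} {f : M → ℝ} (hf : PolyL f)
    (hg : ∀ i ∈ s, PolyL (g i)) (h : ∀ m ∈ Θ, f m * ∏ i ∈ s, g i m = 0)
    (hb : ∀ i ∈ s, ∃ b ∈ Θ, g i b ≠ 0) : ∀ a ∈ Θ, f a = 0 := by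
  induction s using Finset.induction_on generalizing f with
  | empty => simpa using h
  | insert i s his ih =>
    have h1 := ih (f := fun m => f m * g i m) (hf.mul (hg i (Finset.mem_insert_self _ _)))
      (fun j hj => hg j (Finset.mem_insert_of_mem hj))
      (by
        intro m hm
        have := h m hm
        rw [Finset.prod_insert his] at this
        rw [mul_assoc]; exact this)
      (fun j hj => hb j (Finset.mem_insert_of_mem hj))
    exact PolyL.cancel hΘ hf (hg i (Finset.mem_insert_self _ _)) h1
      (hb i (Finset.mem_insert_self _ _))

end PolyLsec

/-- Marginal on `S` of `e` times the product of all kernels but that of `x`. -/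
noncomputable def GG (x : I) (S : Set I) (k : I → (∀ i, α i) → ℝ) (e : (∀ i, α i) → ℝ)
    (w : ∀ i, α i) : ℝ := Mg Sᶜ (fun u => e u * PK k {x}ᶜ u) w

theorem GG_affine (x : I) (S : Set I) (k : I → (∀ i, α i) → ℝ) (e : (∀ i, α i) → ℝ) (c s : ℝ)
    (w : ∀ i, α i) : GG x S k (fun u => c * (s + e u)) w =
      c * (s * GG x S k (fun _ => 1) w + GG x S k e w) := by
  unfold GG
  rw [← Mg_const_mul, ← Mg_add, ← Mg_const_mul]
  apply Mg_congr
  intro u _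
  ring

theorem GG_pos (x : I) (S : Set I) {k : I → (∀ i, α i) → ℝ} (hk : ∀ i v, 0 < k i v)
    {e : (∀ i, α i) → ℝ} (he : ∀ v, 0 < e v) (w : ∀ i, α i) : 0 < GG x S k e w :=
  Mg_pos w fun u => mul_pos (he u) (PK_pos hk _ u)

theorem PolyL_PK (x : I) (u : ∀ i, α i) :
    PolyL (fun θ : (I → (∀ i, α i) → ℝ) × ((∀ i, α i) → ℝ) => PK θ.1 {x}ᶜ u) := by
  unfold PK
  apply PolyL.prod
  intro i _
  by_cases hi : i ∈ ({x}ᶜ : Set I)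
  · simp only [if_pos hi]
    intro a b
    exact ⟨Polynomial.C (a.1 i u) + Polynomial.X * Polynomial.C (b.1 i u - a.1 i u),
      fun t => by simp⟩
  · simp only [if_neg hi]
    exact PolyL.const 1

theorem PolyL_GG (x : I) (S : Set I) (w : ∀ i, α i) :
    PolyL (fun θ : (I → (∀ i, α i) → ℝ) × ((∀ i, α i) → ℝ) => GG x S θ.1 θ.2 w) := by
  unfold GG
  simp only [Mg_eq_filter]
  apply PolyL.sum
  intro u _
  refine PolyL.mul ?_ (PolyL_PK x u)
  intro a b
  exact ⟨Polynomial.C (a.2 u) + Polynomial.X * Polynomial.C (b.2 u - a.2 u),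
    fun t => by simp⟩

theorem PolyL_GG1 (x : I) (S : Set I) (w : ∀ i, α i) :
    PolyL (fun θ : (I → (∀ i, α i) → ℝ) × ((∀ i, α i) → ℝ) => GG x S θ.1 (fun _ => 1) w) := by
  unfold GG
  simp only [Mg_eq_filter]
  apply PolyL.sum
  intro u _
  exact PolyL.mul (PolyL.const 1) (PolyL_PK x u)

/-- The parameter space. -/
def Par (E : I → I → Prop) (x : I) (α : I → Type*) [∀ i, Fintype (α i)] :
    Set ((I → (∀ i, α i) → ℝ) × ((∀ i, α i) → ℝ)) :=
  {θ | IsKer E θ.1 ∧ DepOn θ.2 {j | E j x}}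

theorem Par_convex {E : I → I → Prop} {x : I} : ∀ a ∈ Par E x α, ∀ b ∈ Par E x α,
    ∀ t : ℝ, 0 ≤ t → t ≤ 1 → a + t • (b - a) ∈ Par E x α := by
  rintro ⟨k, e⟩ ⟨hk, he⟩ ⟨k', e'⟩ ⟨hk', he'⟩ t h0 h1
  simp only at hk he hk' he'
  refine ⟨⟨fun i v => ?_, fun i v w hvw => ?_, fun i v => ?_⟩, fun v w hvw => ?_⟩
  · have q1 := hk.pos i v
    have q2 := hk'.pos i v
    simp only [Prod.fst_add, Prod.smul_fst, Prod.fst_sub, Pi.add_apply, Pi.smul_apply,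
      Pi.sub_apply, smul_eq_mul]
    rcases h0.eq_or_lt with h | h
    · rw [← h]; linarith
    · have := mul_pos h q2
      have := mul_nonneg (sub_nonneg.2 h1) q1.le
      nlinarith
  · simp only [Prod.fst_add, Prod.smul_fst, Prod.fst_sub, Pi.add_apply, Pi.smul_apply,
      Pi.sub_apply, smul_eq_mul]
    rw [hk.dep i v w hvw, hk'.dep i v w hvw]
  · have e1 : (((k, e) + t • ((k', e') - (k, e))).1 i) = fun u => (1 - t) * k i u + t * k' i u := by
      funext u
      simp only [Prod.fst_add, Prod.smul_fst, Prod.fst_sub, Pi.add_apply, Pi.smul_apply,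
        Pi.sub_apply, smul_eq_mul]
      ring
    rw [e1, Mg_add, Mg_const_mul, Mg_const_mul, hk.sum, hk'.sum]
    ring
  · simp only [Prod.snd_add, Prod.smul_snd, Prod.snd_sub, Pi.add_apply, Pi.smul_apply,
      Pi.sub_apply, smul_eq_mul]
    rw [he v w hvw, he' v w hvw]

theorem adj_ident {E : I → I → Prop} (hdag : Irreflexive (Relation.TransGen E))
    {Z : Set I} {x y : I} (hxy : y ≠ x)
    (hZ : Disjoint Z (descendants E {x}))
    (hadj : IsAdjustmentSet (α := α) E {x} {y} Z)
    {k : I → (∀ i, α i) → ℝ} (hk : IsKer E k) (hcard : 1 < Fintype.card (α x))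
    {h : (∀ i, α i) → ℝ} (hdep : DepOn h {j | E j x}) (h0 : ∀ u, 0 < h u) (h1 : ∀ u, h u < 1)
    (v0 : ∀ i, α i) :
    Mg Z (fun w => GG x ({y} ∪ ({x} ∪ Z)) k h w / GG x ({x} ∪ Z) k h w *
      GG x ({x} ∪ Z) k (fun _ => 1) w) v0 = Mg ({x} ∪ {y})ᶜ (PK k {x}ᶜ) v0 := by
  set n : ℝ := (Fintype.card (α x) : ℝ) - 1 with hn
  have hn0 : 0 < n := by
    have : (1 : ℝ) < Fintype.card (α x) := by exact_mod_cast hcard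
    rw [hn]; linarith
  set c := v0 x with hc
  set k' : I → (∀ i, α i) → ℝ := fun m u =>
    if m = x then (if u x = c then h u else (1 - h u) / n) else k m u with hk'
  have hxx : ¬ E x x := fun hE => acyc_ne hdag hE rfl
  have hhx : ∀ u a, h (Function.update u x a) = h u := by
    intro u a
    apply hdep
    intro i hi
    rw [Function.update_of_ne]
    rintro rfl
    exact hxx hi
  have hker : IsKer E k' := by
    refine ⟨fun m u => ?_, fun m u u' huu => ?_, fun m u => ?_⟩
    · simp only [hk']
      split_ifs
      · exact h0 u
      · exact div_pos (by linarith [h1 u]) hn0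
      · exact hk.pos _ _
    · simp only [hk']
      by_cases hm : m = x
      · subst hm
        rw [if_pos rfl, if_pos rfl, huu m (by simp), hdep u u' (fun i hi => huu i (by simp; exact Or.inr hi))]
      · rw [if_neg hm, if_neg hm, hk.dep m u u' huu]
    · by_cases hm : m = x
      · subst hm
        rw [Mg_singleton]
        simp only [hk', if_true, Function.update_self, hhx]
        rw [← Finset.add_sum_erase _ _ (Finset.mem_univ c), if_pos rfl,
          Finset.sum_congr rfl (g := fun _ => (1 - h u) / n) (by
            intro a ha
            rw [if_neg (Finset.ne_of_mem_erase ha)]), Finset.sum_const,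
          Finset.card_erase_of_mem (Finset.mem_univ _), nsmul_eq_mul, Finset.card_univ,
          Nat.cast_sub Fintype.card_pos, Nat.cast_one, ← hn]
        field_simp
        ring
      · rw [← hk.sum m u]
        apply Mg_congr
        intro u _
        simp only [hk', if_neg hm]
  have hPK : PK k' {x}ᶜ = PK k {x}ᶜ := by
    funext u
    unfold PK
    refine Finset.prod_congr rfl fun m _ => ?_
    by_cases hm : m ∈ ({x}ᶜ : Set I)
    · rw [if_pos hm, if_pos hm]
      have : m ≠ x := hm
      simp only [hk', if_neg this]
    · rw [if_neg hm, if_neg hm]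
  obtain ⟨hq1, hq2, hq3⟩ := markov_of_ker hdag hker
  have hA := hadj _ hq1 hq2 hq3 v0 v0
  rw [do_eq (k := k') (condPr_ker hdag hker) {x} {y} v0 v0 v0 (fun _ _ => rfl) (fun _ _ => rfl),
    merge_sum {x} Z v0 v0 (fun w => condPr (PK k' Set.univ) {y} ({x} ∪ Z) w *
      prS (PK k' Set.univ) Z w), hPK] at hA
  simp only [ite_self] at hA
  rw [hA]
  have hxZ : x ∉ Z := fun hx => Set.disjoint_left.1 hZ hx (sub_desc rfl)
  apply Mg_congr
  intro w hw
  have hwx : w x = c := hw x hxZ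
  have hS : ∀ S : Set I, x ∈ S → prS (PK k' Set.univ) S w = GG x S k h w := by
    intro S hxS
    rw [prS_eq]
    unfold GG
    apply Mg_congr
    intro u hu
    have hux : u x = c := by rw [hu x (by simpa using hxS), hwx]
    rw [PK_univ_split k' x, hPK]
    simp only [hk', if_true, hux]
  have hD : prS (PK k' Set.univ) Z w = GG x ({x} ∪ Z) k (fun _ => 1) w := by
    rw [prS_eq]
    have := marg_nd hdag hker (X := {x}) (S := ∅) (e := fun _ => 1) hZ
      (fun _ _ _ => rfl) (by simp) w
    rw [hPK] at this
    unfold GG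
    rw [← this]
    simp
  unfold condPr
  rw [hS _ (by simp), hS _ (by simp), hD]

theorem adj_pf {E : I → I → Prop} (hdag : Irreflexive (Relation.TransGen E))
    {Z : Set I} {x y : I} (hxy : y ≠ x)
    (hZ : Disjoint Z (descendants E {x}))
    (hadj : IsAdjustmentSet (α := α) E {x} {y} Z)
    {k : I → (∀ i, α i) → ℝ} (hk : IsKer E k) (hcard : 1 < Fintype.card (α x))
    {e : (∀ i, α i) → ℝ} (hdep : DepOn e {j | E j x}) (v0 : ∀ i, α i) :
    ∃ s0 : ℝ, ∀ s, s0 ≤ s →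
      ∑ w ∈ Finset.univ.filter (fun w : ∀ i, α i => ∀ i, i ∉ Z → w i = v0 i),
        (GG x ({y} ∪ ({x} ∪ Z)) k e w - GG x ({y} ∪ ({x} ∪ Z)) k (fun _ => 1) w *
          (GG x ({x} ∪ Z) k e w / GG x ({x} ∪ Z) k (fun _ => 1) w)) /
        (s + GG x ({x} ∪ Z) k e w / GG x ({x} ∪ Z) k (fun _ => 1) w) = 0 := by
  set B : ℝ := ∑ u, |e u| with hB
  have hBe : ∀ u, |e u| ≤ B := fun u => Finset.single_le_sum (f := fun u => |e u|)
    (fun _ _ => abs_nonneg _) (Finset.mem_univ u)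
  have hB0 : 0 ≤ B := Finset.sum_nonneg fun _ _ => abs_nonneg _
  refine ⟨B + 1, fun s hs => ?_⟩
  have hpos : ∀ u, 0 < s + e u := fun u => by
    have := hBe u
    have := neg_abs_le (e u)
    linarith
  set c : ℝ := 1 / (s + B + 1) with hc
  have hc0 : 0 < c := by rw [hc]; apply div_pos one_pos; linarith
  have i1 := adj_ident hdag hxy hZ hadj hk hcard (h := fun u => c * (s + e u))
    (fun u u' huu => by show c * (s + e u) = c * (s + e u'); rw [hdep u u' huu])
    (fun u => mul_pos hc0 (hpos u))
    (fun u => by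
      show c * (s + e u) < 1
      rw [hc, div_mul_eq_mul_div, one_mul, div_lt_one (by linarith)]
      have := hBe u
      have := le_abs_self (e u)
      linarith) v0
  have i2 := adj_ident hdag hxy hZ hadj hk hcard (h := fun u => 1 / 2)
    (fun u u' huu => rfl) (fun u => by norm_num) (fun u => by norm_num) v0
  rw [← i2, Mg_eq_filter, Mg_eq_filter, ← sub_eq_zero, ← Finset.sum_sub_distrib] at i1
  rw [← i1]
  refine Finset.sum_congr rfl fun w _ => ?_
  have hhalf : ∀ S, GG x S k (fun _ => 1 / 2) w = 1 / 2 * GG x S k (fun _ => 1) w := by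
    intro S
    unfold GG
    rw [← Mg_const_mul]
    apply Mg_congr
    intro u _
    ring
  have hD1 : 0 < GG x ({x} ∪ Z) k (fun _ => 1) w := GG_pos _ _ hk.pos (fun _ => one_pos) _
  have hDs : 0 < GG x ({x} ∪ Z) k (fun u => c * (s + e u)) w :=
    GG_pos _ _ hk.pos (fun u => mul_pos hc0 (hpos u)) _
  rw [GG_affine] at hDs
  have hDs' : 0 < s * GG x ({x} ∪ Z) k (fun _ => 1) w + GG x ({x} ∪ Z) k e w :=
    (mul_pos_iff_of_pos_left hc0).1 hDs
  rw [hhalf, hhalf, GG_affine, GG_affine]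
  generalize GG x ({x} ∪ Z) k (fun _ => 1) w = D1 at *
  generalize GG x ({x} ∪ Z) k e w = De at *
  generalize GG x ({y} ∪ ({x} ∪ Z)) k (fun _ => 1) w = N1 at *
  generalize GG x ({y} ∪ ({x} ∪ Z)) k e w = Ne at *
  have hs2 : s + De / D1 = (s * D1 + De) / D1 := by field_simp
  rw [hs2]
  have := hD1.ne'
  have := hDs'.ne'
  have := hc0.ne'
  clear i1 i2
  obtain ⟨R, hR⟩ : ∃ R, R = s * D1 + De := ⟨_, rfl⟩
  have hDe : De = R - s * D1 := by rw [hR]; ring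
  have hR0 : R ≠ 0 := by rw [hR]; exact hDs'.ne'
  rw [← hR, hDe]
  field_simp
  ring


theorem Ex_eq_GG {E : I → I → Prop} (hdag : Irreflexive (Relation.TransGen E))
    {Z : Set I} {x : I} (hZ : Disjoint Z (descendants E {x}))
    {k : I → (∀ i, α i) → ℝ} (hk : IsKer E k)
    {e : (∀ i, α i) → ℝ} (hdep : DepOn e {j | E j x}) (w : ∀ i, α i) :
    Ex Z k e w = GG x ({x} ∪ Z) k e w := by
  unfold Ex GG
  apply marg_nd hdag hk hZ hdep
  rw [Set.disjoint_left]
  rintro j hj ⟨s, hs, hsj⟩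
  rw [Set.mem_singleton_iff] at hs
  subst hs
  exact hdag j (Relation.TransGen.head' hj hsj)

theorem fiber_zero {E : I → I → Prop} (hdag : Irreflexive (Relation.TransGen E))
    {Z Z1 : Set I} {x y : I} (hxy : y ≠ x)
    (hZ : Disjoint Z (descendants E {x}))
    (hadj : IsAdjustmentSet (α := α) E {x} {y} Z) (hcard : 1 < Fintype.card (α x))
    (hZ1 : ∀ j ∈ Z1, j ∈ Z ∧ ∃ (v : ∀ i, α i) (b : α j),
      PSep E {j | E j x} Z v (Function.update v j b))
    {k : I → (∀ i, α i) → ℝ} (hk : IsKer E k)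
    {e : (∀ i, α i) → ℝ} (hdep : DepOn e {j | E j x}) (v0 : ∀ i, α i) :
    ∑ w ∈ (Finset.univ.filter (fun w : ∀ i, α i => ∀ i, i ∉ Z → w i = v0 i)) with
        (∀ j ∈ Z1, w j = v0 j),
      (GG x ({y} ∪ ({x} ∪ Z)) k e w - GG x ({y} ∪ ({x} ∪ Z)) k (fun _ => 1) w *
        (GG x ({x} ∪ Z) k e w / GG x ({x} ∪ Z) k (fun _ => 1) w)) = 0 := by
  set Ω := Finset.univ.filter (fun w : ∀ i, α i => ∀ i, i ∉ Z → w i = v0 i) with hΩ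
  set Q : (∀ i, α i) → Prop := fun w => ∀ j ∈ Z1, w j = v0 j with hQ
  set N : (I → (∀ i, α i) → ℝ) → ((∀ i, α i) → ℝ) → (∀ i, α i) → ℝ :=
    fun k e w => GG x ({y} ∪ ({x} ∪ Z)) k e w with hN
  set D : (I → (∀ i, α i) → ℝ) → ((∀ i, α i) → ℝ) → (∀ i, α i) → ℝ :=
    fun k e w => GG x ({x} ∪ Z) k e w with hD
  set prs := (Ω ×ˢ Ω).filter (fun q => Q q.1 ∧ ¬ Q q.2) with hprs
  set g : (∀ i, α i) × (∀ i, α i) → (I → (∀ i, α i) → ℝ) × ((∀ i, α i) → ℝ) → ℝ :=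
    fun q θ => D θ.1 θ.2 q.1 * D θ.1 (fun _ => 1) q.2 -
      D θ.1 θ.2 q.2 * D θ.1 (fun _ => 1) q.1 with hg
  set f : (I → (∀ i, α i) → ℝ) × ((∀ i, α i) → ℝ) → ℝ := fun θ =>
    ∑ w ∈ Ω.filter Q, (N θ.1 θ.2 w * D θ.1 (fun _ => 1) w - N θ.1 (fun _ => 1) w * D θ.1 θ.2 w) *
      ∏ w' ∈ (Ω.filter Q).erase w, D θ.1 (fun _ => 1) w' with hf
  have hD1 : ∀ k, IsKer E k → ∀ w, 0 < D k (fun _ => 1) w := fun k hk w =>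
    GG_pos _ _ hk.pos (fun _ => one_pos) _
  have hfe : ∀ θ ∈ Par E x α, f θ = (∏ w' ∈ Ω.filter Q, D θ.1 (fun _ => 1) w') *
      ∑ w ∈ Ω.filter Q, (N θ.1 θ.2 w - N θ.1 (fun _ => 1) w *
        (D θ.1 θ.2 w / D θ.1 (fun _ => 1) w)) := by
    intro θ hθ
    rw [hf, Finset.mul_sum]
    refine Finset.sum_congr rfl fun w hw => ?_
    rw [← Finset.mul_prod_erase _ _ hw]
    have := (hD1 θ.1 hθ.1 w).ne'
    field_simp
  have hfP : PolyL f := by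
    apply PolyL.sum
    intro w _
    refine PolyL.mul (PolyL.sub (PolyL.mul (PolyL_GG _ _ _) (PolyL_GG1 _ _ _))
      (PolyL.mul (PolyL_GG1 _ _ _) (PolyL_GG _ _ _))) ?_
    exact PolyL.prod fun w' _ => PolyL_GG1 _ _ _
  have hgP : ∀ q ∈ prs, PolyL (g q) := fun q _ =>
    PolyL.sub (PolyL.mul (PolyL_GG _ _ _) (PolyL_GG1 _ _ _))
      (PolyL.mul (PolyL_GG _ _ _) (PolyL_GG1 _ _ _))
  have hzero : ∀ θ ∈ Par E x α, f θ * ∏ q ∈ prs, g q θ = 0 := by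
    intro θ hθ
    by_cases hprod : ∏ q ∈ prs, g q θ = 0
    · rw [hprod, mul_zero]
    · replace hprod := Finset.prod_ne_zero_iff.1 hprod
      obtain ⟨s0, hs0⟩ := adj_pf hdag hxy hZ hadj hθ.1 hcard hθ.2 v0
      have := pf_lemma Ω (fun w => N θ.1 θ.2 w - N θ.1 (fun _ => 1) w *
        (D θ.1 θ.2 w / D θ.1 (fun _ => 1) w)) (fun w => D θ.1 θ.2 w / D θ.1 (fun _ => 1) w) s0
        hs0 Q (by
          intro w hw w' hw' hq hq' heq
          have hm : (w, w') ∈ prs := by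
            rw [hprs, Finset.mem_filter, Finset.mem_product]
            exact ⟨⟨hw, hw'⟩, hq, hq'⟩
          apply hprod _ hm
          rw [div_eq_div_iff (hD1 θ.1 hθ.1 w).ne' (hD1 θ.1 hθ.1 w').ne'] at heq
          exact sub_eq_zero.2 heq)
      rw [hfe θ hθ]
      refine mul_eq_zero_of_left (mul_eq_zero_of_right _ ?_) _
      convert this
  have hex : ∀ q ∈ prs, ∃ θ ∈ Par E x α, g q θ ≠ 0 := by
    rintro ⟨w, w'⟩ hq
    rw [hprs, Finset.mem_filter] at hq
    obtain ⟨_, hw, hw'⟩ := hq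
    simp only [hQ, not_forall] at hw hw'
    obtain ⟨j, hj, hne⟩ := hw'
    obtain ⟨hjZ, v, b, hP⟩ := hZ1 j hj
    obtain ⟨k', e', hk', he', hne'⟩ := PSep_all (w := w) (w' := w') hjZ hP
      (by rw [hw j hj]; exact fun h => hne h.symm)
    refine ⟨(k', e'), ⟨hk', he'⟩, ?_⟩
    rw [Ex_eq_GG hdag hZ hk' he', Ex_eq_GG hdag hZ hk' he',
      Ex_eq_GG hdag hZ hk' (fun _ _ _ => rfl), Ex_eq_GG hdag hZ hk' (fun _ _ _ => rfl)] at hne'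
    exact sub_ne_zero.2 hne'
  have h0 := PolyL.cancel_prod (Par_convex (E := E) (x := x)) hfP hgP hzero hex (k, e) ⟨hk, hdep⟩
  rw [hfe (k, e) ⟨hk, hdep⟩] at h0
  refine (mul_eq_zero.1 h0).resolve_left ?_
  exact (Finset.prod_pos fun w _ => hD1 k hk w).ne'

theorem GG_Mg (x : I) {C Z Z1 : Set I} (hZ1 : Z1 ⊆ Z) (hC : ∀ i ∈ C, i ∉ Z)
    (k : I → (∀ i, α i) → ℝ) (e : (∀ i, α i) → ℝ) (v : ∀ i, α i) :
    Mg (Z \ Z1) (GG x (C ∪ Z) k e) v = GG x (C ∪ Z1) k e v := by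
  unfold GG
  rw [Mg_Mg]
  · congr 1
    ext i
    have h1 := @hZ1 i
    have h2 := hC i
    simp only [Set.mem_union, Set.mem_diff, Set.mem_compl_iff]
    clear * - h1 h2
    tauto
  · rw [Set.disjoint_left]
    rintro i hi hi'
    exact hi' (Or.inr hi.1)

theorem fiber_id {E : I → I → Prop} (hdag : Irreflexive (Relation.TransGen E))
    {Z Z1 : Set I} {x y : I} (hxy : y ≠ x) (hyZ : y ∉ Z)
    (hZ : Disjoint Z (descendants E {x}))
    (hadj : IsAdjustmentSet (α := α) E {x} {y} Z) (hcard : 1 < Fintype.card (α x))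
    {k : I → (∀ i, α i) → ℝ} (hk : IsKer E k)
    (hZ1 : Z1 = {j | j ∈ Z ∧ ∃ (v : ∀ i, α i) (b : α j) (e : (∀ i, α i) → ℝ),
      DepOn e {j | E j x} ∧
      Ex Z k e v * Ex Z k (fun _ => 1) (Function.update v j b) ≠
        Ex Z k e (Function.update v j b) * Ex Z k (fun _ => 1) v})
    {e : (∀ i, α i) → ℝ} (hdep : DepOn e {j | E j x}) (v0 : ∀ i, α i) :
    GG x ({y} ∪ ({x} ∪ Z1)) k e v0 * GG x ({x} ∪ Z1) k (fun _ => 1) v0 =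
      GG x ({y} ∪ ({x} ∪ Z1)) k (fun _ => 1) v0 * GG x ({x} ∪ Z1) k e v0 := by
  have hxZ : x ∉ Z := fun hx => Set.disjoint_left.1 hZ hx (sub_desc rfl)
  have hsub : Z1 ⊆ Z := by
    rw [hZ1]; exact fun j hj => hj.1
  have h0 := fiber_zero hdag hxy hZ hadj hcard (Z1 := Z1) (by
    intro j hj
    rw [hZ1] at hj
    obtain ⟨hj, v, b, e, he, hne⟩ := hj
    exact ⟨hj, v, b, k, e, hk, he, hne⟩) hk hdep v0
  have hD1 : ∀ w, 0 < GG x ({x} ∪ Z) k (fun _ => 1) w := fun w =>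
    GG_pos _ _ hk.pos (fun _ => one_pos) _
  have hup : ∀ j, j ∈ Z → j ∉ Z1 → ∀ (v : ∀ i, α i) (b : α j),
      GG x ({x} ∪ Z) k e v * GG x ({x} ∪ Z) k (fun _ => 1) (Function.update v j b) =
        GG x ({x} ∪ Z) k e (Function.update v j b) * GG x ({x} ∪ Z) k (fun _ => 1) v := by
    intro j hj hj1 v b
    by_contra hne
    apply hj1
    rw [hZ1]
    refine ⟨hj, v, b, e, hdep, ?_⟩
    rw [Ex_eq_GG hdag hZ hk hdep, Ex_eq_GG hdag hZ hk hdep,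
      Ex_eq_GG hdag hZ hk (fun _ _ _ => rfl), Ex_eq_GG hdag hZ hk (fun _ _ _ => rfl)]
    exact hne
  set lam := GG x ({x} ∪ Z) k e v0 / GG x ({x} ∪ Z) k (fun _ => 1) v0 with hlam
  have hconst : ∀ w : ∀ i, α i, (∀ i, i ∉ Z \ Z1 → w i = v0 i) →
      GG x ({x} ∪ Z) k e w = lam * GG x ({x} ∪ Z) k (fun _ => 1) w := by
    intro w hw
    have key : ∀ s : Finset I, GG x ({x} ∪ Z) k e (s.piecewise w v0) =
        lam * GG x ({x} ∪ Z) k (fun _ => 1) (s.piecewise w v0) := by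
      intro s
      induction s using Finset.induction_on with
      | empty =>
        rw [Finset.piecewise_empty, hlam, div_mul_cancel₀ _ (hD1 v0).ne']
      | insert j s hjs ih =>
        rw [Finset.piecewise_insert]
        by_cases hj : j ∈ Z \ Z1
        · have := hup j hj.1 hj.2 (s.piecewise w v0) (w j)
          rw [ih] at this
          apply mul_right_cancel₀ (hD1 (s.piecewise w v0)).ne'
          rw [← this]
          ring
        · have : w j = s.piecewise w v0 j := by
            rw [Finset.piecewise_eq_of_notMem _ _ _ hjs, hw j hj]
          rw [this, Function.update_eq_self]
          exact ih
    have := key Finset.univ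
    rwa [Finset.piecewise_univ] at this
  have hset : ∀ S1 : Set I, ({y} ∪ ({x} ∪ S1) : Set I) = ({y} ∪ {x}) ∪ S1 := fun S1 => by
    rw [Set.union_assoc]
  have hCxy : ∀ i ∈ ({y} ∪ {x} : Set I), i ∉ Z := by
    rintro i (rfl | rfl)
    · exact hyZ
    · exact hxZ
  have hCx : ∀ i ∈ ({x} : Set I), i ∉ Z := by
    rintro i rfl
    exact hxZ
  have hmem : ∀ w : ∀ i, α i, ((∀ i, i ∉ Z → w i = v0 i) ∧ (∀ j ∈ Z1, w j = v0 j)) ↔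
      ∀ i, i ∉ Z \ Z1 → w i = v0 i := by
    intro w
    constructor
    · rintro ⟨h1, h2⟩ i hi
      by_cases hiZ : i ∈ Z
      · exact h2 i (by by_contra h; exact hi ⟨hiZ, h⟩)
      · exact h1 i hiZ
    · intro h
      exact ⟨fun i hi => h i fun h' => hi h'.1, fun i hi => h i fun h' => h'.2 hi⟩
  have hDe : GG x ({x} ∪ Z1) k e v0 = lam * GG x ({x} ∪ Z1) k (fun _ => 1) v0 := by
    rw [← GG_Mg x hsub hCx, ← GG_Mg x hsub hCx, ← Mg_const_mul]
    exact Mg_congr hconst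
  have hNe : GG x ({y} ∪ ({x} ∪ Z1)) k e v0 =
      lam * GG x ({y} ∪ ({x} ∪ Z1)) k (fun _ => 1) v0 := by
    rw [hset, ← GG_Mg x hsub hCxy, ← GG_Mg x hsub hCxy, ← Mg_const_mul]
    generalize Z \ Z1 = Z2 at hmem hconst ⊢
    rw [← sub_eq_zero, ← h0, Mg_eq_filter, Mg_eq_filter, ← Finset.sum_sub_distrib]
    refine Finset.sum_congr (by
      ext w
      rw [Finset.mem_filter, Finset.mem_filter, Finset.mem_filter, ← hmem w]
      simp) fun w hw => ?_
    rw [Finset.mem_filter, Finset.mem_filter] at hw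
    rw [hconst w ((hmem w).1 ⟨hw.1.2, hw.2⟩), mul_div_cancel_right₀ _ (hD1 w).ne', hset]
    ring
  rw [hDe, hNe]
  ring

theorem GG_ind (x : I) (S A : Set I) (k : I → (∀ i, α i) → ℝ) (v : ∀ i, α i) :
    GG x S k (fun u => if ∀ i ∈ A, u i = v i then 1 else 0) v = Mg (S ∪ A)ᶜ (PK k {x}ᶜ) v := by
  unfold GG Mg
  refine Finset.sum_congr rfl fun u _ => ?_
  by_cases h1 : ∀ i ∈ A, u i = v i
  · by_cases h2 : ∀ i, i ∉ Sᶜ → u i = v i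
    · rw [if_pos h2, if_pos]
      · simp only [if_pos h1, one_mul]
      intro i hi
      rcases not_not.1 hi with h | h
      · exact h2 i (by simpa using h)
      · exact h1 i h
    · rw [if_neg h2, if_neg]
      intro h
      apply h2
      intro i hi
      exact h i (fun hc => hc (Or.inl (not_not.1 hi)))
  · have h3 : ¬ ∀ i, i ∉ (S ∪ A)ᶜ → u i = v i := by
      intro h
      apply h1
      intro i hi
      exact h i (fun hc => hc (Or.inr hi))
    rw [if_neg h3]
    simp only [if_neg h1, zero_mul, ite_self]

theorem complete {E : I → I → Prop} (hdag : Irreflexive (Relation.TransGen E))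
    {p : (∀ i, α i) → ℝ} (hpos : ∀ v, 0 < p v) (hmarkov : MarkovCompat p E)
    (hf : Faithful p E)
    {Z : Set I} {x y : I} (hxy : y ≠ x) (hyx : ¬ Anc E y x) (hyZ : y ∉ Z)
    (hZ : Disjoint Z (descendants E {x}))
    (hcard : 1 < Fintype.card (α x))
    (hadj : IsAdjustmentSet (α := α) E {x} {y} Z) :
    ∃ Z1 ⊆ Z, AdjSep E {x} y Z1 := by
  obtain ⟨hk, hp⟩ := ker_of_markov hdag hpos hmarkov
  set k := fun i => condPr p {i} {j | E j i} with hkdef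
  clear_value k
  set A : Set I := {j | E j x} with hA
  obtain ⟨Z1, hZ1⟩ : ∃ Z1 : Set I, Z1 = {j | j ∈ Z ∧ ∃ (v : ∀ i, α i) (b : α j)
      (e : (∀ i, α i) → ℝ), DepOn e {j | E j x} ∧
      Ex Z k e v * Ex Z k (fun _ => 1) (Function.update v j b) ≠
        Ex Z k e (Function.update v j b) * Ex Z k (fun _ => 1) v} := ⟨_, rfl⟩
  have hsub : Z1 ⊆ Z := by
    rw [hZ1]; exact fun j hj => hj.1
  refine ⟨Z1, hsub, ?_⟩
  apply AdjSep_of_condIndep hdag hf hyx (fun h => hyZ (hsub h))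
  intro v
  set e : (∀ i, α i) → ℝ := fun u => if ∀ i ∈ A, u i = v i then 1 else 0 with he
  set e2 : (∀ i, α i) → ℝ := fun u => k x (Function.update u x (v x)) with he2
  have hde : DepOn e {j | E j x} := by
    intro u u' huu
    have : (∀ i ∈ A, u i = v i) ↔ (∀ i ∈ A, u' i = v i) := by
      constructor
      · intro h i hi
        rw [← huu i hi]; exact h i hi
      · intro h i hi
        rw [huu i hi]; exact h i hi
    simp only [he, this]
  have hde2 : DepOn e2 {j | E j x} := by
    intro u u' huu
    apply hk.dep
    intro i hi
    by_cases hix : i = x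
    · subst hix; simp
    · rw [Function.update_of_ne hix, Function.update_of_ne hix]
      exact huu i (hi.resolve_left hix)
  have i1 := fiber_id hdag hxy hyZ hZ hadj hcard hk hZ1 hde v
  have i2 := fiber_id hdag hxy hyZ hZ hadj hcard hk hZ1 hde2 v
  have hP2 : ∀ S : Set I, x ∈ S → prS p S v = GG x S k e2 v := by
    intro S hxS
    rw [hp, prS_eq]
    unfold GG
    apply Mg_congr
    intro u hu
    rw [PK_univ_split k x, he2]
    have : Function.update u x (v x) = u := by
      rw [← hu x (by simpa using hxS), Function.update_eq_self]
    simp only [this]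
  have hP1 : ∀ S : Set I, x ∈ S → prS p (S ∪ A) v = k x v * GG x S k e v := by
    intro S hxS
    rw [hp, prS_eq, he, GG_ind]
    rw [Mg_congr (G := fun u => k x u * PK k {x}ᶜ u) (fun u _ => PK_univ_split k x u)]
    apply Mg_mul_left'
    intro u hu
    apply hk.dep
    intro i hi
    apply hu
    simp only [Set.mem_compl_iff, not_not]
    rcases hi with rfl | hi
    · exact Or.inl hxS
    · exact Or.inr hi
  have s1 : ({y} ∪ (A \ Z1)) ∪ ({x} ∪ Z1) = ({y} ∪ ({x} ∪ Z1)) ∪ A := by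
    ext i
    simp only [Set.mem_union, Set.mem_diff]
    clear * -
    tauto
  have s2 : (A \ Z1) ∪ ({x} ∪ Z1) = ({x} ∪ Z1) ∪ A := by
    ext i
    simp only [Set.mem_union, Set.mem_diff]
    clear * -
    tauto
  unfold condPr
  rw [s1, s2, hP1 _ (by simp), hP1 _ (by simp), hP2 _ (by simp), hP2 _ (by simp)]
  have p1 : 0 < GG x ({x} ∪ Z1) k (fun _ => 1) v := GG_pos _ _ hk.pos (fun _ => one_pos) _
  have p2 : 0 < GG x ({x} ∪ Z1) k e2 v := GG_pos _ _ hk.pos (fun _ => hk.pos _ _) _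
  generalize GG x ({x} ∪ Z1) k (fun _ => 1) v = D1 at *
  generalize GG x ({x} ∪ Z1) k e2 v = D2 at *
  generalize GG x ({x} ∪ Z1) k e v = De at *
  generalize GG x ({y} ∪ ({x} ∪ Z1)) k (fun _ => 1) v = N1 at *
  generalize GG x ({y} ∪ ({x} ∪ Z1)) k e2 v = N2 at *
  generalize GG x ({y} ∪ ({x} ∪ Z1)) k e v = Ne at *
  have h3 : Ne * D2 = N2 * De := by
    apply mul_right_cancel₀ p1.ne'
    linear_combination D2 * i1 - De * i2
  have p2' := p2.ne'
  have : k x v * Ne / D2 = k x v * (Ne * D2) / (D2 * D2) := by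
    field_simp
  rw [this, h3]
  field_simp


theorem card_of_dep {p : (∀ i, α i) → ℝ} {x w y : I} {T : Set I}
    (hdep : ¬ CondIndep p {w} {y} T) (hindep : CondIndep p {w} {y} (T ∪ {x})) :
    1 < Fintype.card (α x) := by
  by_contra hc
  have hss : Subsingleton (α x) := Fintype.card_le_one_iff_subsingleton.1 (not_lt.1 hc)
  apply hdep
  have hpr : ∀ (S : Set I) (v : ∀ i, α i), prS p (S ∪ {x}) v = prS p S v := by
    intro S v
    unfold prS
    have : {u : ∀ i, α i | ∀ i ∈ S ∪ {x}, u i = v i} = {u : ∀ i, α i | ∀ i ∈ S, u i = v i} := by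
      ext u
      constructor
      · intro h i hi
        exact h i (Or.inl hi)
      · rintro h i (hi | hi)
        · exact h i hi
        · rw [Set.mem_singleton_iff] at hi
          subst hi
          exact Subsingleton.elim _ _
    rw [this]
  intro v
  have := hindep v
  unfold condPr at this ⊢
  simp only [← Set.union_assoc, hpr] at this
  exact this

theorem exists_minimal_adj (E : I → I → Prop) (X Y : Set I) :
    ∀ T : Set I, IsAdjustmentSet (α := α) E X Y T →
      ∃ Z ⊆ T, MinimalAdjustmentSet (α := α) E X Y Z := by
  intro T
  induction T using (inferInstance : WellFoundedLT (Set I)).wf.induction with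
  | _ T ih =>
    intro hT
    by_cases h : ∀ Z', Z' ⊂ T → ¬ IsAdjustmentSet (α := α) E X Y Z'
    · exact ⟨T, subset_rfl, hT, h⟩
    · push Not at h
      obtain ⟨Z', hZ', hadj⟩ := h
      obtain ⟨Z, hZ, hmin⟩ := ih Z' hZ' hadj
      exact ⟨Z, hZ.trans hZ'.subset, hmin⟩


/-- **R1 Combine.** Given a positive pmf `p` Markov compatible with and faithful to
the DAG `E`, with treatments `X i`, witnesses `Wf i`, and sets
`T i ⊆ (W \ range Wf) ∪ (range X \ De(X i))` satisfying the conditional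
dependence/independence conditions: every `X i` has a directed path to `Y` with at
least one edge, each `T i` is an adjustment set relative to `({X i}, {Y})`, each `T i`
contains a minimal adjustment set `Zᵢ`, and for every choice of minimal adjustment sets
`Zf i ⊆ T i`, the set `(⋃ i, Zf i) \ range X` is an adjustment set relative to
`(range X, {Y})`. -/
theorem stmt_9 (E : I → I → Prop)
    (hdag : Irreflexive (Relation.TransGen E))
    (p : (∀ i, α i) → ℝ) (hpmf : IsPMF p) (hpos : ∀ v, 0 < p v)
    (hmarkov : MarkovCompat p E) (hfaith : Faithful p E)
    (k : ℕ) (X : Fin (k + 1) → I) (hXinj : Function.Injective X)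
    (Y : I) (W : Set I)
    (hXY : ∀ i, X i ≠ Y) (hXW : ∀ i, X i ∉ W) (hYW : Y ∉ W)
    (hordWX : ∀ i, ∀ w ∈ W, ¬ Anc E (X i) w)
    (hordWY : ∀ w ∈ W, ¬ Anc E Y w)
    (hordXY : ∀ i, ¬ Anc E Y (X i))
    (Wf : Fin (k + 1) → I) (hWf : ∀ i, Wf i ∈ W)
    (T : Fin (k + 1) → Set I)
    (hT : ∀ i, T i ⊆ (W \ Set.range Wf) ∪ (Set.range X \ descendants E {X i}))
    (hdep : ∀ i, ¬ CondIndep p {Wf i} {Y} (T i))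
    (hindep : ∀ i, CondIndep p {Wf i} {Y} (T i ∪ {X i})) :
    (∀ i, Relation.TransGen E (X i) Y) ∧
      (∀ i, IsAdjustmentSet (α := α) E {X i} {Y} (T i)) ∧
      (∀ i, ∃ Zi ⊆ T i, MinimalAdjustmentSet (α := α) E {X i} {Y} Zi) ∧
      (∀ Zf : Fin (k + 1) → Set I,
        (∀ i, Zf i ⊆ T i ∧ MinimalAdjustmentSet (α := α) E {X i} {Y} (Zf i)) →
        IsAdjustmentSet (α := α) E (Set.range X) {Y}
          ((⋃ i, Zf i) \ Set.range X)) := by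
  have hTY : ∀ i, Y ∉ T i := by
    intro i h
    rcases hT i h with h | h
    · exact hYW h.1
    · obtain ⟨j, hj⟩ := h.1
      exact hXY j hj
  have hxT : ∀ i, ∀ t ∈ T i, ¬ Anc E (X i) t := by
    intro i t ht hanc
    rcases hT i ht with h | h
    · exact hordWX i t h.1 hanc
    · exact h.2 ⟨X i, rfl, hanc⟩
  have hwT : ∀ i, Wf i ∉ T i := by
    intro i h
    rcases hT i h with h | h
    · exact h.2 ⟨i, rfl⟩
    · obtain ⟨j, hj⟩ := h.1
      exact hXW j (hj ▸ hWf i)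
  have hwy : ∀ i, Wf i ≠ Y := fun i h => hYW (h ▸ hWf i)
  have hs := fun i => step1_prob hdag hpos hmarkov hfaith (hdep i) (hindep i)
    (hordWX i _ (hWf i)) (hxT i) (hwT i) (hXY i).symm (hTY i) (hwy i)
  have hdisj : ∀ i, ∀ Z ⊆ T i, Disjoint Z (descendants E {X i}) := by
    intro i Z hZ
    rw [Set.disjoint_left]
    rintro t ht ⟨s, hs, hanc⟩
    rw [Set.mem_singleton_iff] at hs
    subst hs
    exact hxT i t (hZ ht) hanc
  have hsound : ∀ i, ∀ Z ⊆ T i, AdjSep E {X i} Y Z →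
      IsAdjustmentSet (α := α) E {X i} {Y} Z := fun i Z hZ h =>
    soundness hdag (fun h' => hXY i h'.symm) (fun h' => hTY i (hZ h')) (hdisj i Z hZ) h
  have hadjT : ∀ i, IsAdjustmentSet (α := α) E {X i} {Y} (T i) := fun i =>
    hsound i _ subset_rfl (hs i).2
  refine ⟨fun i => ?_, hadjT, fun i => exists_minimal_adj E _ _ _ (hadjT i), ?_⟩
  · rcases Relation.reflTransGen_iff_eq_or_transGen.1 (hs i).1 with h | h
    · exact absurd h.symm (hXY i)
    · exact h
  · intro Zf hZf
    have hmin : ∀ i, ∀ Z1 ⊆ Zf i, AdjSep E {X i} Y Z1 → Z1 = Zf i := by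
      intro i Z1 hsub hsep
      by_contra hne
      exact (hZf i).2.2 Z1 (hsub.ssubset_of_ne hne) (hsound i Z1 (hsub.trans (hZf i).1) hsep)
    have hsep : ∀ i, AdjSep E {X i} Y (Zf i) := by
      intro i
      obtain ⟨Z1, hsub, h1⟩ := complete hdag hpos hmarkov hfaith (hXY i).symm (hordXY i)
        (fun h => hTY i ((hZf i).1 h)) (hdisj i _ (hZf i).1)
        (card_of_dep (hdep i) (hindep i)) (hZf i).2.1
      rw [← hmin i Z1 hsub h1]
      exact h1
    have hanc : ∀ i, Zf i ⊆ AncS E {Y} := by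
      intro i z hz
      rw [← hmin i _ Set.inter_subset_left (AdjSep_inter (hsep i))] at hz
      obtain ⟨s, hs', hzs⟩ := hz.2
      rcases hs' with rfl | hs'
      · exact ⟨Y, rfl, hzs.trans (hs i).1⟩
      · exact ⟨s, hs', hzs⟩
    have hZW : (⋃ i, Zf i) \ Set.range X ⊆ W := by
      rintro z ⟨hz, hzX⟩
      obtain ⟨i, hi⟩ := Set.mem_iUnion.1 hz
      rcases hT i ((hZf i).1 hi) with h | h
      · exact h.1
      · exact absurd h.1 hzX
    refine soundness hdag ?_ (fun h => hYW (hZW h)) ?_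
      (AdjSep_joint hsep (fun i => (hs i).1) hanc)
    · rintro ⟨j, hj⟩
      exact hXY j hj
    · rw [Set.disjoint_left]
      rintro z hz ⟨_, ⟨j, rfl⟩, hjz⟩
      exact hordWX j z (hZW hz) hjz
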